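/- Let H be a complex Hilbert space and let A = C + T, where C is a non-negative compact operator on H such that lim_{n→∞} n^2 s_n(C) = ∞ and lim_{n→∞} n^α s_n(C) = a for some constants 0 < α < 2 and 0 < a < ∞, and T is a compact operator belonging to the Schatten–von Neumann class S_q for some 0 < q ≤ 1/α. Then A cannot be a Volterra operator; that is, A has at least one nonzero eigenvalue. -/

import Mathlib

open Filter Topology

/-- The `n`-th singular value (`s`-number) of an operator on a Hilbert space,
indexed so that `sNum T 1 = ‖T‖` is the first singular value: `sNum T n` is the
distance from `T` to the operators of rank `< n`.  For compact operators this
coincides with the usual sequence of eigenvalues of `|T| = (T^*T)^{1/2}`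
arranged in non-increasing order, counted with multiplicity. -/
noncomputable def sNum {H : Type*} [NormedAddCommGroup H] [InnerProductSpace ℂ H]
    (T : H →L[ℂ] H) (n : ℕ) : ℝ :=
  ⨅ F : {F : H →L[ℂ] H // Module.rank ℂ (LinearMap.range (F : H →ₗ[ℂ] H)) < (n : Cardinal)},
    ‖T - (F : H →L[ℂ] H)‖

section PartP0

section SN
variable {H : Type*} [NormedAddCommGroup H] [InnerProductSpace ℂ H]

theorem card_lt_succ_iff (x : Cardinal) (n : ℕ) : x < ((n + 1 : ℕ) : Cardinal) ↔ x ≤ n := by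
  rw [Nat.cast_succ, ← Cardinal.succ_natCast]
  exact Order.lt_succ_iff

theorem sNum_nonneg (T : H →L[ℂ] H) (n : ℕ) : 0 ≤ sNum T n :=
  Real.iInf_nonneg fun _ => norm_nonneg _

theorem sNum_le (T F : H →L[ℂ] H) (n : ℕ)
    (hF : Module.rank ℂ (LinearMap.range (F : H →ₗ[ℂ] H)) ≤ n) : sNum T (n + 1) ≤ ‖T - F‖ :=
  ciInf_le (⟨0, by rintro _ ⟨_, rfl⟩; exact norm_nonneg _⟩)
    (⟨F, (card_lt_succ_iff _ _).2 hF⟩ : {F : H →L[ℂ] H // Module.rank ℂ (LinearMap.range (F : H →ₗ[ℂ] H)) < ((n+1 : ℕ) : Cardinal)})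

theorem zero_rank (n : ℕ) :
    Module.rank ℂ (LinearMap.range ((0 : H →L[ℂ] H) : H →ₗ[ℂ] H)) ≤ n := by
  have : (((0 : H →L[ℂ] H) : H →ₗ[ℂ] H)) = 0 := rfl
  rw [this, LinearMap.range_zero]
  simp

theorem le_sNum (T : H →L[ℂ] H) (n : ℕ) (x : ℝ)
    (h : ∀ F : H →L[ℂ] H, Module.rank ℂ (LinearMap.range (F : H →ₗ[ℂ] H)) ≤ n → x ≤ ‖T - F‖) :
    x ≤ sNum T (n + 1) := by
  haveI : Nonempty {F : H →L[ℂ] H // Module.rank ℂ (LinearMap.range (F : H →ₗ[ℂ] H)) < ((n+1 : ℕ) : Cardinal)} :=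
    ⟨⟨0, (card_lt_succ_iff _ _).2 (zero_rank n)⟩⟩
  exact le_ciInf fun F => h F.1 ((card_lt_succ_iff _ _).1 F.2)

theorem exists_of_sNum_lt (T : H →L[ℂ] H) (n : ℕ) (x : ℝ) (h : sNum T (n + 1) < x) :
    ∃ F : H →L[ℂ] H, Module.rank ℂ (LinearMap.range (F : H →ₗ[ℂ] H)) ≤ n ∧ ‖T - F‖ < x := by
  by_contra hc
  push Not at hc
  exact absurd (le_sNum T n x hc) (not_le.2 h)

theorem sNum_anti (T : H →L[ℂ] H) : Antitone (fun n => sNum T (n + 1)) := by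
  intro m n h
  refine le_sNum T m _ fun F hF => sNum_le T F n (hF.trans ?_)
  exact_mod_cast h

theorem rank_add_le' (F G : H →L[ℂ] H) (m n : ℕ)
    (hF : Module.rank ℂ (LinearMap.range (F : H →ₗ[ℂ] H)) ≤ m)
    (hG : Module.rank ℂ (LinearMap.range (G : H →ₗ[ℂ] H)) ≤ n) :
    Module.rank ℂ (LinearMap.range ((F + G : H →L[ℂ] H) : H →ₗ[ℂ] H)) ≤ (m + n : ℕ) := by
  have : ((F + G : H →L[ℂ] H) : H →ₗ[ℂ] H) = (F : H →ₗ[ℂ] H) + (G : H →ₗ[ℂ] H) := rfl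
  rw [this]
  refine (LinearMap.rank_add_le _ _).trans ?_
  push_cast
  exact add_le_add hF hG

theorem sNum_add_le (S T : H →L[ℂ] H) (m n : ℕ) :
    sNum (S + T) (m + n + 1) ≤ sNum S (m + 1) + sNum T (n + 1) := by
  refine le_of_forall_pos_le_add fun ε hε => ?_
  obtain ⟨F, hF, hF'⟩ := exists_of_sNum_lt S m (sNum S (m+1) + ε/2) (by linarith)
  obtain ⟨G, hG, hG'⟩ := exists_of_sNum_lt T n (sNum T (n+1) + ε/2) (by linarith)
  refine (sNum_le (S + T) (F + G) (m + n) (rank_add_le' F G m n hF hG)).trans ?_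
  have : S + T - (F + G) = (S - F) + (T - G) := by abel
  rw [this]
  refine (norm_add_le _ _).trans ?_
  linarith

theorem rank_mul_left' (F G : H →L[ℂ] H) (m : ℕ)
    (hF : Module.rank ℂ (LinearMap.range (F : H →ₗ[ℂ] H)) ≤ m) :
    Module.rank ℂ (LinearMap.range ((F * G : H →L[ℂ] H) : H →ₗ[ℂ] H)) ≤ m := by
  refine le_trans ?_ hF
  exact LinearMap.rank_comp_le_left (G : H →ₗ[ℂ] H) (F : H →ₗ[ℂ] H)

theorem rank_mul_right' (F G : H →L[ℂ] H) (m : ℕ)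
    (hG : Module.rank ℂ (LinearMap.range (G : H →ₗ[ℂ] H)) ≤ m) :
    Module.rank ℂ (LinearMap.range ((F * G : H →L[ℂ] H) : H →ₗ[ℂ] H)) ≤ m := by
  refine le_trans ?_ hG
  exact LinearMap.rank_comp_le_right (G : H →ₗ[ℂ] H) (F : H →ₗ[ℂ] H)

theorem sNum_mul_le (S T : H →L[ℂ] H) (m n : ℕ) :
    sNum (S * T) (m + n + 1) ≤ sNum S (m + 1) * sNum T (n + 1) := by
  have key : ∀ ε > 0, sNum (S * T) (m + n + 1) ≤ (sNum S (m + 1) + ε) * (sNum T (n + 1) + ε) := by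
    intro ε hε
    obtain ⟨F, hF, hF'⟩ := exists_of_sNum_lt S m (sNum S (m+1) + ε) (by linarith)
    obtain ⟨G, hG, hG'⟩ := exists_of_sNum_lt T n (sNum T (n+1) + ε) (by linarith)
    have hr := rank_add_le' (F * (T - G)) (S * G) m n (rank_mul_left' _ _ _ hF) (rank_mul_right' _ _ _ hG)
    refine (sNum_le (S * T) _ (m + n) hr).trans ?_
    have : S * T - (F * (T - G) + S * G) = (S - F) * (T - G) := by noncomm_ring
    rw [this]
    refine (norm_mul_le _ _).trans ?_
    gcongr
    have := sNum_nonneg S (m+1)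
    linarith
  have h1 : Tendsto (fun ε : ℝ => (sNum S (m + 1) + ε) * (sNum T (n + 1) + ε)) (𝓝[>] 0)
      (𝓝 ((sNum S (m + 1) + 0) * (sNum T (n + 1) + 0))) := by
    apply Tendsto.mono_left _ nhdsWithin_le_nhds
    apply Continuous.tendsto
    fun_prop
  simp only [add_zero] at h1
  exact ge_of_tendsto h1 (eventually_mem_nhdsWithin.mono fun ε hε => key ε hε)

theorem sNum_le_norm (T : H →L[ℂ] H) (n : ℕ) : sNum T (n + 1) ≤ ‖T‖ := by
  simpa using sNum_le T 0 n (zero_rank n)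
end SN

end PartP0

section PartP1


theorem exists_comb_ker {E F : Type*} [AddCommGroup E] [Module ℂ E] [AddCommGroup F] [Module ℂ F]
    (i : ℕ) (b : Fin (i+1) → E) (G : E →ₗ[ℂ] F)
    (hG : Module.rank ℂ (LinearMap.range G) ≤ i) :
    ∃ a : Fin (i+1) → ℂ, a ≠ 0 ∧ G (∑ k, a k • b k) = 0 := by
  let f : (Fin (i+1) → ℂ) →ₗ[ℂ] LinearMap.range G :=
    G.rangeRestrict ∘ₗ (Fintype.linearCombination ℂ b)
  have hfin : Module.Finite ℂ (LinearMap.range G) := by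
    apply Module.rank_lt_aleph0_iff.1
    exact lt_of_le_of_lt hG (Cardinal.natCast_lt_aleph0)
  have h1 : Module.finrank ℂ (LinearMap.range G) < Module.finrank ℂ (Fin (i+1) → ℂ) := by
    rw [Module.finrank_fin_fun]
    have := Module.finrank_le_of_rank_le (R := ℂ) (M := LinearMap.range G) (n := i) hG
    omega
  have := LinearMap.ker_ne_bot_of_finrank_lt (f := f) h1
  obtain ⟨a, ha, ha0⟩ := (Submodule.ne_bot_iff _).1 this
  refine ⟨a, ha0, ?_⟩
  have := congrArg Subtype.val (LinearMap.mem_ker.1 ha)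
  simpa [f, Fintype.linearCombination_apply] using this

section FD
variable {V : Type*} [NormedAddCommGroup V] [InnerProductSpace ℂ V] [FiniteDimensional ℂ V]

theorem det_le_one_aux {ι : Type*} [Fintype ι] [DecidableEq ι] (b : OrthonormalBasis ι ℂ V) (B : V →ₗ[ℂ] V)
    (h : ∀ i, ‖B (b i)‖ = 1) : ‖LinearMap.det B‖ ≤ 1 := by
  have hsym : (LinearMap.adjoint B ∘ₗ B).IsSymmetric := LinearMap.isSymmetric_adjoint_mul_self B
  have hpos := B.isPositive_adjoint_comp_self
  have hdet := hsym.det_eq_prod_eigenvalues rfl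
  have htr := hsym.re_trace_eq_sum_eigenvalues rfl
  have htr2 : RCLike.re (LinearMap.trace ℂ V (LinearMap.adjoint B ∘ₗ B)) = Fintype.card ι := by
    rw [LinearMap.trace_eq_sum_inner _ b]
    simp [LinearMap.adjoint_inner_right, h]
  have hd : Fintype.card ι = Module.finrank ℂ V := (Module.finrank_eq_card_basis b.toBasis).symm
  have h2 : ‖LinearMap.det B‖^2 = ∏ i, hsym.eigenvalues rfl i := by
    have h1 := LinearMap.normDet_sq B
    rw [LinearMap.normDet_eq_norm_det, hdet] at h1
    have h2 := congrArg Complex.re h1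
    rw [← RCLike.ofReal_prod] at h2
    exact h2
  have h3 : ∏ i, hsym.eigenvalues rfl i ≤ 1 := by
    calc ∏ i, hsym.eigenvalues rfl i ≤ ∏ i, Real.exp (hsym.eigenvalues rfl i - 1) := by
          apply Finset.prod_le_prod
          · intro i _; exact hpos.nonneg_eigenvalues rfl i
          · intro i _
            linarith [Real.add_one_le_exp (hsym.eigenvalues rfl i - 1)]
      _ = Real.exp (∑ i, (hsym.eigenvalues rfl i - 1)) := (Real.exp_sum _ _).symm
      _ = 1 := by
          rw [Finset.sum_sub_distrib, ← htr, htr2, hd]; simp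
  rw [← h2] at h3
  nlinarith [norm_nonneg (LinearMap.det B)]

theorem hadamard_det {ι : Type*} [Fintype ι] [DecidableEq ι] (b : OrthonormalBasis ι ℂ V) (B : V →ₗ[ℂ] V) :
    ‖LinearMap.det B‖ ≤ ∏ i, ‖B (b i)‖ := by
  by_cases h0 : ∃ i, B (b i) = 0
  · obtain ⟨i, hi⟩ := h0
    have : LinearMap.det B = 0 := by
      by_contra h
      have hu := isUnit_iff_ne_zero.2 h
      have := LinearMap.isUnit_iff_isUnit_det B |>.2 hu
      have hk := (LinearMap.isUnit_iff_ker_eq_bot B).1 this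
      have h1 : b i ∈ LinearMap.ker B := hi
      rw [hk] at h1
      have h2 : b i = 0 := by simpa using h1
      have := b.norm_eq_one i
      simp [h2] at this
    rw [this]; simp; positivity
  · push Not at h0
    let D : V →ₗ[ℂ] V := b.toBasis.constr ℂ (fun i => ((‖B (b i)‖⁻¹ : ℝ) : ℂ) • b i)
    have hD : ∀ i, D (b i) = ((‖B (b i)‖⁻¹ : ℝ) : ℂ) • b i := by
      intro i
      have := b.toBasis.constr_basis ℂ (fun i => ((‖B (b i)‖⁻¹ : ℝ) : ℂ) • b i) i
      simpa [D] using this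
    have h1 := det_le_one_aux b (B ∘ₗ D) (by
      intro i
      simp only [LinearMap.comp_apply, hD, map_smul, norm_smul]
      have : ‖B (b i)‖ ≠ 0 := by simpa using h0 i
      simp [this])
    have hdetD : LinearMap.det D = ∏ i, ((‖B (b i)‖⁻¹ : ℝ) : ℂ) := by
      rw [← LinearMap.det_toMatrix b.toBasis]
      have : LinearMap.toMatrix b.toBasis b.toBasis D = Matrix.diagonal (fun i => ((‖B (b i)‖⁻¹ : ℝ) : ℂ)) := by
        ext i j
        rw [LinearMap.toMatrix_apply]
        simp only [OrthonormalBasis.coe_toBasis, hD, map_smul]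
        by_cases hij : i = j
        · subst hij; simp
        · simp [hij, Matrix.diagonal_apply_ne _ hij]
      rw [this, Matrix.det_diagonal]
    rw [LinearMap.det_comp, hdetD, norm_mul, norm_prod] at h1
    have hp : 0 < ∏ i, ‖B (b i)‖ := Finset.prod_pos (fun i _ => by simpa using h0 i)
    have h3 : ∏ i, ‖((‖B (b i)‖⁻¹ : ℝ) : ℂ)‖ = (∏ i, ‖B (b i)‖)⁻¹ := by
      rw [← Finset.prod_inv_distrib]
      apply Finset.prod_congr rfl
      intro i _
      simp
    rw [h3, ← div_eq_mul_inv, div_le_one hp] at h1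
    exact h1

theorem exists_svd_basis (X : V →ₗ[ℂ] V) (σ : ℕ → ℝ)
    (hσ : ∀ j : ℕ, ∃ G : V →ₗ[ℂ] V, Module.rank ℂ (LinearMap.range G) ≤ j ∧ ∀ v, ‖X v - G v‖ ≤ σ j * ‖v‖) :
    ∃ b : OrthonormalBasis (Fin (Module.finrank ℂ V)) ℂ V, ∀ i, ‖X (b i)‖ ≤ σ i := by
  have hsym : (LinearMap.adjoint X ∘ₗ X).IsSymmetric := LinearMap.isSymmetric_adjoint_mul_self X
  have hpos := X.isPositive_adjoint_comp_self
  set b := hsym.eigenvectorBasis rfl with hb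
  set l := hsym.eigenvalues rfl with hl
  have hanti : Antitone l := hsym.eigenvalues_antitone rfl
  have happ : ∀ i, LinearMap.adjoint X (X (b i)) = (l i : ℂ) • b i := fun i => hsym.apply_eigenvectorBasis rfl i
  have hin : ∀ i j, inner ℂ (X (b i)) (X (b j)) = if i = j then (l j : ℂ) else 0 := by
    intro i j
    rw [← LinearMap.adjoint_inner_right, happ, inner_smul_right, b.inner_eq_ite]
    simp
  refine ⟨b, fun i => ?_⟩
  obtain ⟨G, hGr, hG⟩ := hσ i
  let e : Fin (i+1) → Fin (Module.finrank ℂ V) := fun k => ⟨k, by omega⟩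
  have he : Function.Injective e := by
    intro k k' h; simpa [e, Fin.ext_iff] using h
  obtain ⟨a, ha0, ha⟩ := exists_comb_ker i (fun k => b (e k)) G hGr
  have hXb : ‖X (b i)‖^2 = l i := by
    have := hin i i
    rw [inner_self_eq_norm_sq_to_K] at this
    simp at this
    exact_mod_cast this
  have hv : ‖∑ k, a k • b (e k)‖^2 = ∑ k, ‖a k‖^2 := by
    have h := inner_self_eq_norm_sq (𝕜 := ℂ) (∑ k, a k • b (e k))
    have h2 : inner ℂ (∑ k, a k • b (e k)) (∑ k, a k • b (e k)) = ∑ k, ((‖a k‖^2 : ℝ) : ℂ) := by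
      refine ((b.orthonormal.comp e he).inner_sum a a Finset.univ).trans ?_
      apply Finset.sum_congr rfl
      intro k _
      rw [mul_comm, Complex.mul_conj, Complex.normSq_eq_norm_sq]
    rw [h2, ← Complex.ofReal_sum] at h
    exact h.symm
  have hXv : ‖X (∑ k, a k • b (e k))‖^2 = ∑ k, ‖a k‖^2 * l (e k) := by
    have h := inner_self_eq_norm_sq (𝕜 := ℂ) (X (∑ k, a k • b (e k)))
    have h2 : inner ℂ (X (∑ k, a k • b (e k))) (X (∑ k, a k • b (e k))) = ∑ k, ((‖a k‖^2 * l (e k) : ℝ) : ℂ) := by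
      simp only [map_sum, map_smul, sum_inner, inner_sum, inner_smul_left, inner_smul_right, hin]
      apply Finset.sum_congr rfl
      intro k _
      rw [Finset.sum_eq_single k]
      · simp only [if_true]
        push_cast
        rw [← Complex.ofReal_pow, ← Complex.normSq_eq_norm_sq, ← Complex.mul_conj]; ring
      · intro k' _ hk
        have : e k ≠ e k' := fun h => hk (he h).symm
        simp [Ne.symm hk, he.eq_iff]
        intro h; exact absurd h hk
      · simp
    rw [h2, ← Complex.ofReal_sum] at h
    exact h.symm
  have hvpos : 0 < ∑ k, ‖a k‖^2 := by
    obtain ⟨k, hk⟩ := Function.ne_iff.1 ha0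
    have hk' : a k ≠ 0 := by simpa using hk
    exact Finset.sum_pos' (fun _ _ => by positivity) ⟨k, Finset.mem_univ _, by positivity⟩
  have h1 := hG (∑ k, a k • b (e k))
  rw [ha, sub_zero] at h1
  have hlow : l i * ∑ k, ‖a k‖^2 ≤ ‖X (∑ k, a k • b (e k))‖^2 := by
    rw [hXv, Finset.mul_sum]
    apply Finset.sum_le_sum
    intro k _
    rw [mul_comm]
    have : l i ≤ l (e k) := hanti (by
      rw [Fin.le_def]; simp [e]; omega)
    gcongr
  have hvn : 0 < ‖∑ k, a k • b (e k)‖ := by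
    rw [← hv] at hvpos
    by_contra h
    have : ‖∑ k, a k • b (e k)‖ = 0 := le_antisymm (not_lt.1 h) (norm_nonneg _)
    rw [this] at hvpos; simp at hvpos
  have hσ0 : 0 ≤ σ i := by
    by_contra h
    push Not at h
    nlinarith [norm_nonneg (X (∑ k, a k • b (e k)))]
  have h2 : (‖X (b i)‖ * ‖∑ k, a k • b (e k)‖)^2 ≤ (σ i * ‖∑ k, a k • b (e k)‖)^2 := by
    rw [mul_pow, hXb, hv]
    refine hlow.trans ?_
    exact pow_le_pow_left₀ (norm_nonneg _) h1 2
  have h3 := abs_le_of_sq_le_sq' h2 (by positivity)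
  exact le_of_mul_le_mul_right h3.2 hvn
end FD

end PartP1

section PartP2


section FD2
variable {V : Type*} [NormedAddCommGroup V] [InnerProductSpace ℂ V] [FiniteDimensional ℂ V]

/-- approximation numbers of `X` bounded by `σ` in finite dimension -/
def fdApprox (X : V →ₗ[ℂ] V) (σ : ℕ → ℝ) : Prop :=
  ∀ j : ℕ, ∃ G : V →ₗ[ℂ] V, Module.rank ℂ (LinearMap.range G) ≤ j ∧ ∀ v, ‖X v - G v‖ ≤ σ j * ‖v‖

theorem fd_det_le (X : V →ₗ[ℂ] V) (σ : ℕ → ℝ) (hσ : fdApprox X σ) (z : ℂ) :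
    ‖LinearMap.det (1 - z • X)‖ ≤ ∏ i ∈ Finset.range (Module.finrank ℂ V), (1 + ‖z‖ * σ i) := by
  obtain ⟨b, hb⟩ := exists_svd_basis X σ hσ
  rw [Finset.prod_range]
  refine (hadamard_det b _).trans (Finset.prod_le_prod (fun _ _ => norm_nonneg _) fun i _ => ?_)
  have : (1 - z • X) (b i) = b i - z • X (b i) := by simp
  rw [this]
  refine (norm_sub_le _ _).trans ?_
  rw [norm_smul, b.norm_eq_one]
  gcongr
  exact hb i

theorem real_aux_32 {y u n : ℝ} (hy : 0 ≤ y) (hu : |u| ≤ y) (hn : 0 ≤ n) (h1 : n ≤ 1 + y)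
    (h2 : n ^ 2 = 1 - 2 * u + y ^ 2) : n * Real.exp u ≤ Real.exp (2 * y ^ (3/2 : ℝ)) := by
  by_cases hy1 : y ≤ 1
  · have h3 : n ^ 2 ≤ (Real.exp (-u + y ^ 2 / 2)) ^ 2 := by
      rw [h2, ← Real.exp_nat_mul]
      have := Real.add_one_le_exp (((2:ℕ):ℝ) * (-u + y ^ 2 / 2))
      refine le_trans (le_of_eq ?_) this
      push_cast; ring
    have h4 : n ≤ Real.exp (-u + y ^ 2 / 2) := (pow_le_pow_iff_left₀ hn (Real.exp_pos _).le (by norm_num)).1 h3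
    calc n * Real.exp u ≤ Real.exp (-u + y ^ 2 / 2) * Real.exp u := by gcongr
      _ = Real.exp (y ^ 2 / 2) := by rw [← Real.exp_add]; ring_nf
      _ ≤ _ := by
        apply Real.exp_le_exp.2
        have : y ^ 2 ≤ y ^ (3/2 : ℝ) := by
          rcases hy.eq_or_lt with h | h
          · rw [← h, Real.zero_rpow (by norm_num)]; norm_num
          · rw [← Real.rpow_natCast]
            exact Real.rpow_le_rpow_of_exponent_ge h hy1 (by norm_num)
        have h0 : 0 ≤ y ^ (3/2 : ℝ) := Real.rpow_nonneg hy _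
        nlinarith
  · push Not at hy1
    have h4 : n ≤ Real.exp y := h1.trans (by linarith [Real.add_one_le_exp y])
    calc n * Real.exp u ≤ Real.exp y * Real.exp y := by
          gcongr
          exact (le_abs_self u).trans hu
      _ = Real.exp (2 * y) := by rw [← Real.exp_add]; ring_nf
      _ ≤ _ := by
        apply Real.exp_le_exp.2
        have : y ^ (1:ℝ) ≤ y ^ (3/2 : ℝ) := Real.rpow_le_rpow_of_exponent_le hy1.le (by norm_num)
        rw [Real.rpow_one] at this
        linarith

theorem fd_det2_le (X : V →ₗ[ℂ] V) (σ : ℕ → ℝ) (hσ : fdApprox X σ) (z : ℂ) :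
    ‖LinearMap.det (1 - z • X) * Complex.exp (z * LinearMap.trace ℂ V X)‖ ≤
      Real.exp (2 * ‖z‖ ^ (3/2 : ℝ) * ∑ i ∈ Finset.range (Module.finrank ℂ V), σ i ^ (3/2 : ℝ)) := by
  obtain ⟨b, hb⟩ := exists_svd_basis X σ hσ
  rw [norm_mul, Complex.norm_exp, LinearMap.trace_eq_sum_inner X b, Finset.mul_sum, Complex.re_sum,
    Real.exp_sum]
  calc _ ≤ (∏ i, ‖(1 - z • X) (b i)‖) * ∏ i, Real.exp (z * inner ℂ (b i) (X (b i))).re := by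
        gcongr
        exact hadamard_det b _
    _ = ∏ i, (‖(1 - z • X) (b i)‖ * Real.exp (z * inner ℂ (b i) (X (b i))).re) := by
        rw [Finset.prod_mul_distrib]
    _ ≤ ∏ i : Fin (Module.finrank ℂ V), Real.exp (2 * ‖z‖ ^ (3/2 : ℝ) * σ i ^ (3/2 : ℝ)) := by
        apply Finset.prod_le_prod
        · intros; positivity
        intro i _
        have e1 : (1 - z • X) (b i) = b i - z • X (b i) := by simp
        rw [e1]
        have hbn : ‖b i‖ = 1 := b.norm_eq_one i
        have e2 : z * inner ℂ (b i) (X (b i)) = inner ℂ (b i) (z • X (b i)) := by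
          rw [inner_smul_right]
        rw [e2]
        set w := z • X (b i) with hw
        have hwn : ‖w‖ ≤ ‖z‖ * σ i := by
          rw [hw, norm_smul]; gcongr; exact hb i
        have hσi : 0 ≤ σ i := (norm_nonneg _).trans (hb i)
        refine (real_aux_32 (norm_nonneg w) ?_ (norm_nonneg _) ?_ ?_).trans ?_
        · refine (Complex.abs_re_le_norm _).trans ((norm_inner_le_norm _ _).trans ?_)
          rw [hbn, one_mul]
        · refine (norm_sub_le _ _).trans ?_
          rw [hbn]
        · rw [@norm_sub_sq ℂ, hbn]; norm_num
        · apply Real.exp_le_exp.2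
          rw [mul_assoc, ← Real.mul_rpow (norm_nonneg _) hσi]
          gcongr
    _ = _ := by
        rw [← Real.exp_sum, Finset.mul_sum, Finset.sum_range]

theorem fd_trace_le (X : V →ₗ[ℂ] V) (σ : ℕ → ℝ) (hσ : fdApprox X σ) :
    ‖LinearMap.trace ℂ V X‖ ≤ ∑ i ∈ Finset.range (Module.finrank ℂ V), σ i := by
  obtain ⟨b, hb⟩ := exists_svd_basis X σ hσ
  rw [LinearMap.trace_eq_sum_inner X b, Finset.sum_range]
  refine norm_sum_le_of_le _ fun i _ => ?_
  refine (norm_inner_le_norm _ _).trans ?_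
  rw [b.norm_eq_one, one_mul]
  exact hb i

theorem fd_extend {N : ℕ} (e : Fin N → V) (he : Orthonormal ℂ e) :
    ∃ (u : Finset V) (b : OrthonormalBasis u ℂ V), (∀ j, e j ∈ u) ∧ ⇑b = ((↑) : u → V) := by
  have := he.toSubtypeRange
  obtain ⟨u, b, h1, h2⟩ := this.exists_orthonormalBasis_extension
  exact ⟨u, b, fun j => h1 ⟨j, rfl⟩, h2⟩

theorem fd_detC_le {N : ℕ} (e : Fin N → V) (he : Orthonormal ℂ e) (c : Fin N → ℝ)
    (C : V →ₗ[ℂ] V) (hC : ∀ x, C x = ∑ j, ((c j : ℂ) * inner ℂ (e j) x) • e j) (z : ℂ) :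
    ‖LinearMap.det (1 - z • C)‖ ≤ ∏ j, ‖1 - z * c j‖ := by
  classical
  obtain ⟨u, b, h1, h2⟩ := fd_extend e he
  refine (hadamard_det b _).trans ?_
  let f : Fin N → u := fun j => ⟨e j, h1 j⟩
  have hf : Function.Injective f := fun i j h => he.linearIndependent.injective (congrArg Subtype.val h)
  have hbf : ∀ j, b (f j) = e j := fun j => by rw [h2]
  have hbe : ∀ x : u, x ∉ Finset.univ.map ⟨f, hf⟩ → C (b x) = 0 := by
    intro x hx
    rw [hC]
    apply Finset.sum_eq_zero
    intro j _
    rw [← hbf j, b.orthonormal.inner_eq_zero]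
    · simp
    · rintro rfl
      exact hx (by simp)
  have hCe : ∀ j, C (e j) = (c j : ℂ) • e j := by
    intro j
    rw [hC, Finset.sum_eq_single j]
    · rw [inner_self_eq_norm_sq_to_K, he.1]; simp
    · intro i _ hij
      rw [he.inner_eq_zero hij]; simp
    · simp
  apply le_of_eq
  rw [← Finset.prod_subset (Finset.subset_univ (Finset.univ.map ⟨f, hf⟩))]
  · rw [Finset.prod_map]
    apply Finset.prod_congr rfl
    intro j _
    have : (1 - z • C) (b (f j)) = (1 - z * c j) • e j := by
      simp [hbf, hCe, sub_smul, mul_smul]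
    simp only [Function.Embedding.coeFn_mk]
    rw [this, norm_smul, he.1, mul_one]
  · intro x _ hx
    have : (1 - z • C) (b x) = b x := by simp [hbe x hx]
    rw [this, b.norm_eq_one]

theorem fd_det_pert (C F : V →ₗ[ℂ] V) (τ : ℕ → ℝ) (hτ : fdApprox F τ) (z : ℂ) (s : ℝ) (hs : 0 < s)
    (hz : ∀ y : ℝ, 0 ≤ y → s ≤ ‖1 - z * y‖) (hC : ∀ v, ∃ y : ℝ, 0 ≤ y ∧ inner ℂ v (C v) = (y : ℂ)) :
    ‖LinearMap.det (1 - z • (C + F))‖ ≤ ‖LinearMap.det (1 - z • C)‖ *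
      ∏ i ∈ Finset.range (Module.finrank ℂ V), (1 + ‖z‖ * (τ i / s)) := by
  set Q : V →ₗ[ℂ] V := 1 - z • C with hQ
  have hQv : ∀ v, s * ‖v‖ ≤ ‖Q v‖ := by
    intro v
    by_cases hv : v = 0
    · simp [hv]
    have hv' : 0 < ‖v‖ := norm_pos_iff.2 hv
    obtain ⟨y, hy, hy2⟩ := hC v
    have h1 : inner ℂ v (Q v) = ((‖v‖ ^ 2 : ℝ) : ℂ) * (1 - z * (y / ‖v‖ ^ 2 : ℝ)) := by
      have : Q v = v - z • C v := by simp [hQ]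
      rw [this, inner_sub_right, inner_smul_right, hy2, inner_self_eq_norm_sq_to_K]
      have : (‖v‖ : ℂ) ≠ 0 := by exact_mod_cast hv'.ne'
      push_cast
      field_simp
      rfl
    have h2 := norm_inner_le_norm (𝕜 := ℂ) v (Q v)
    rw [h1, norm_mul, Complex.norm_real, Real.norm_of_nonneg (by positivity)] at h2
    have h3 := hz (y / ‖v‖ ^ 2) (by positivity)
    have h4 : ‖v‖ ^ 2 * s ≤ ‖v‖ * ‖Q v‖ := le_trans (by gcongr) h2
    nlinarith
  have hinj : Function.Injective Q := by
    rw [injective_iff_map_eq_zero]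
    intro v hv
    have := hQv v
    rw [hv, norm_zero] at this
    exact norm_le_zero_iff.1 (by nlinarith [norm_nonneg v])
  let E := LinearEquiv.ofInjectiveEndo Q hinj
  have hE : ∀ v, Q (E.symm v) = v := fun v => E.apply_symm_apply v
  have hfac : 1 - z • (C + F) = Q * (1 - z • (E.symm.toLinearMap ∘ₗ F)) := by
    ext v
    simp [hQ, smul_add, sub_sub, mul_sub]
    have h := hE (F v)
    simp [hQ] at h
    rw [← sub_eq_zero]
    have : F v = E.symm (F v) - z • C (E.symm (F v)) := h.symm
    nth_rw 1 [this]
    module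
  rw [hfac, map_mul, norm_mul]
  gcongr
  refine fd_det_le _ _ ?_ z
  intro j
  obtain ⟨G, hG1, hG2⟩ := hτ j
  refine ⟨E.symm.toLinearMap ∘ₗ G, ?_, ?_⟩
  · refine le_trans ?_ hG1
    exact LinearMap.rank_comp_le_right G _ |>.trans le_rfl
  · intro v
    have h1 : (E.symm.toLinearMap ∘ₗ F) v - (E.symm.toLinearMap ∘ₗ G) v = E.symm (F v - G v) := by simp
    rw [h1]
    have h2 := hQv (E.symm (F v - G v))
    rw [hE] at h2
    have := h2.trans (hG2 v)
    rw [div_mul_eq_mul_div, le_div_iff₀ hs]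
    linarith

theorem fd_hasDerivAt_det (X : V →ₗ[ℂ] V) :
    Differentiable ℂ (fun z : ℂ => LinearMap.det (1 - z • X)) ∧
      HasDerivAt (fun z : ℂ => LinearMap.det (1 - z • X)) (-LinearMap.trace ℂ V X) 0 := by
  let b := Module.finBasis ℂ V
  have h1 : (fun z : ℂ => LinearMap.det (1 - z • X)) = fun z : ℂ =>
      (1 + z • (-(LinearMap.toMatrix b b X))).det := by
    funext z
    rw [← LinearMap.det_toMatrix b, map_sub, map_smul, LinearMap.toMatrix_one]
    congr 1
    simp [sub_eq_add_neg]
  rw [h1]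
  have h2 : LinearMap.trace ℂ V X = (LinearMap.toMatrix b b X).trace := LinearMap.trace_eq_matrix_trace ℂ b X
  rw [h2]
  set M := LinearMap.toMatrix b b X
  constructor
  · simp only [Matrix.det_apply]
    refine Differentiable.fun_sum fun p _ => ?_
    refine Differentiable.const_smul (Differentiable.fun_finsetProd fun i _ => ?_) _
    simp only [Matrix.add_apply, Matrix.smul_apply, smul_eq_mul]
    fun_prop
  · have hdet : (fun z : ℂ => (1 + z • (-M)).det) = _ :=
      funext fun z => Matrix.det_one_add_smul z (-M)
    rw [hdet]
    set p := (Matrix.det (1 + (Polynomial.X : Polynomial ℂ) • (-M).map Polynomial.C)).divX.divX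
    have h3 : HasDerivAt (fun z : ℂ => 1 + (-M).trace * z + p.eval z * z ^ 2)
      (0 + (-M).trace * 1 + (p.derivative.eval 0 * 0 ^ 2 + p.eval 0 * (((2:ℕ):ℂ) * 0 ^ (2-1) * 1))) 0 := by
      refine HasDerivAt.add (HasDerivAt.add (hasDerivAt_const _ _) ((hasDerivAt_id _).const_mul _)) ?_
      exact HasDerivAt.mul (p.hasDerivAt 0) ((hasDerivAt_id (0:ℂ)).pow 2)
    convert h3 using 1
    simp [Matrix.trace_neg]
end FD2

end PartP2

section PartP3


section Key
variable {H : Type*} [NormedAddCommGroup H] [InnerProductSpace ℂ H]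

/-- approximation numbers of `X` bounded by `σ` -/
def opApprox (X : H →L[ℂ] H) (σ : ℕ → ℝ) : Prop :=
  ∀ j : ℕ, ∃ G : H →L[ℂ] H, Module.rank ℂ (LinearMap.range (G : H →ₗ[ℂ] H)) ≤ j ∧ ‖X - G‖ ≤ σ j

/-- partial sum of the spectral expansion -/
noncomputable def partC (e : ℕ → H) (c : ℕ → ℝ) (N : ℕ) : H →L[ℂ] H :=
  ∑ j ∈ Finset.range N, (c j : ℂ) • InnerProductSpace.rankOne ℂ (e j) (e j)

theorem partC_apply (e : ℕ → H) (c : ℕ → ℝ) (N : ℕ) (x : H) :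
    partC e c N x = ∑ j ∈ Finset.range N, ((c j : ℂ) * inner ℂ (e j) x) • e j := by
  simp [partC, InnerProductSpace.rankOne_apply, mul_smul]

/-- compression to a finite dimensional subspace -/
noncomputable def cmpr (V : Submodule ℂ H) [FiniteDimensional ℂ V] (X : H →L[ℂ] H) : V →ₗ[ℂ] V :=
  ((V.orthogonalProjectionOnto ∘L X ∘L V.subtypeL : V →L[ℂ] V) : V →ₗ[ℂ] V)

theorem cmpr_apply (V : Submodule ℂ H) [FiniteDimensional ℂ V] (X : H →L[ℂ] H) (v : V) :
    cmpr V X v = V.orthogonalProjectionOnto (X v) := rfl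

theorem cmpr_add (V : Submodule ℂ H) [FiniteDimensional ℂ V] (X Y : H →L[ℂ] H) :
    cmpr V (X + Y) = cmpr V X + cmpr V Y := by
  ext v; simp [cmpr_apply]

theorem cmpr_approx (V : Submodule ℂ H) [FiniteDimensional ℂ V] (X : H →L[ℂ] H) (σ : ℕ → ℝ)
    (h : opApprox X σ) : fdApprox (cmpr V X) σ := by
  intro j
  obtain ⟨G, h1, h2⟩ := h j
  refine ⟨cmpr V G, ?_, ?_⟩
  · refine le_trans ?_ h1
    have : cmpr V G = (V.orthogonalProjectionOnto : H →ₗ[ℂ] V) ∘ₗ ((G : H →ₗ[ℂ] H) ∘ₗ V.subtype) := rfl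
    rw [this]
    refine (LinearMap.rank_comp_le_right _ _).trans ?_
    exact LinearMap.rank_comp_le_left _ _
  · intro v
    have : cmpr V X v - cmpr V G v = V.orthogonalProjectionOnto ((X - G) v) := by
      simp [cmpr_apply]
    rw [this]
    refine (Submodule.norm_orthogonalProjectionOnto_apply_le _ _).trans ?_
    refine ((X - G).le_opNorm _).trans ?_
    exact mul_le_mul_of_nonneg_right h2 (norm_nonneg _)

theorem key_det (e : ℕ → H) (he : Orthonormal ℂ e) (c : ℕ → ℝ) (hc : ∀ j, 0 ≤ c j) (N : ℕ)
    (F : H →L[ℂ] H) (hF : FiniteDimensional ℂ (LinearMap.range (F : H →ₗ[ℂ] H)))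
    (τ σ : ℕ → ℝ) (hτ : opApprox F τ) (hσ : opApprox (partC e c N + F) σ) :
    ∃ (d : ℕ) (t : ℂ) (D : ℂ → ℂ), Differentiable ℂ D ∧ D 0 = 1 ∧ HasDerivAt D (-t) 0 ∧
      (∀ z : ℂ, IsUnit (1 - z • (partC e c N + F)) → D z ≠ 0) ∧
      (∀ z, ‖D z‖ ≤ ∏ i ∈ Finset.range d, (1 + ‖z‖ * σ i)) ∧
      (∀ z, ‖D z * Complex.exp (z * t)‖ ≤
        Real.exp (2 * ‖z‖ ^ (3/2 : ℝ) * ∑ i ∈ Finset.range d, σ i ^ (3/2 : ℝ))) ∧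
      (∀ (z : ℂ) (s : ℝ), 0 < s → (∀ y : ℝ, 0 ≤ y → s ≤ ‖1 - z * y‖) →
        ‖D z‖ ≤ (∏ j ∈ Finset.range N, ‖1 - z * c j‖) *
          ∏ i ∈ Finset.range d, (1 + ‖z‖ * (τ i / s))) ∧
      (∑ j ∈ Finset.range N, c j) - ∑ i ∈ Finset.range d, τ i ≤ t.re := by
  classical
  let e' : Fin N → H := fun j => e j
  have he' : Orthonormal ℂ e' := he.comp _ Fin.val_injective
  let V : Submodule ℂ H := Submodule.span ℂ (Set.range e') ⊔ LinearMap.range (F : H →ₗ[ℂ] H)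
  have : FiniteDimensional ℂ (Submodule.span ℂ (Set.range e')) :=
    FiniteDimensional.span_of_finite ℂ (Set.finite_range e')
  have : FiniteDimensional ℂ V := inferInstanceAs (FiniteDimensional ℂ ↥(_ ⊔ _ : Submodule ℂ H))
  have heV : ∀ j : Fin N, e j ∈ V := fun j =>
    Submodule.mem_sup_left (Submodule.subset_span ⟨j, rfl⟩)
  have hFV : ∀ x, F x ∈ V := fun x => Submodule.mem_sup_right ⟨x, rfl⟩
  let f : Fin N → V := fun j => ⟨e j, heV j⟩
  have hf : Orthonormal ℂ f := by
    constructor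
    · intro j; exact he.1 j
    · intro i j hij
      exact he'.2 hij
  have hCV : ∀ x, partC e c N x ∈ V := by
    intro x
    rw [partC_apply]
    refine V.sum_mem fun j hj => V.smul_mem _ (heV ⟨j, Finset.mem_range.1 hj⟩)
  have hCf : ∀ x : V, cmpr V (partC e c N) x = ∑ j : Fin N, ((c j : ℂ) * inner ℂ (f j) x) • f j := by
    intro x
    rw [cmpr_apply]
    have : partC e c N x = ((∑ j : Fin N, ((c j : ℂ) * inner ℂ (f j) x) • f j : V) : H) := by
      rw [partC_apply, Finset.sum_range]
      simp [f]
    rw [this]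
    exact Submodule.orthogonalProjectionOnto_mem_subspace_eq_self _
  set CN := partC e c N with hCN
  set X := cmpr V (CN + F) with hX
  have hXs : X = cmpr V CN + cmpr V F := cmpr_add _ _ _
  obtain ⟨hd1, hd2⟩ := fd_hasDerivAt_det X
  refine ⟨Module.finrank ℂ V, LinearMap.trace ℂ V X, fun z => LinearMap.det (1 - z • X), hd1, by simp,
    hd2, ?_, fun z => fd_det_le _ _ (cmpr_approx _ _ _ hσ) z,
    fun z => fd_det2_le _ _ (cmpr_approx _ _ _ hσ) z, ?_, ?_⟩
  · intro z hz h0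
    have := LinearMap.bot_lt_ker_of_det_eq_zero h0
    obtain ⟨v, hv, hv0⟩ := (Submodule.ne_bot_iff _).1 this.ne'
    rw [LinearMap.mem_ker] at hv
    apply hv0
    have h1 : (v : H) - z • (CN + F) v = 0 := by
      have h2 : ((X v : V) : H) = (CN + F) v := by
        rw [hX, cmpr_apply]
        exact Submodule.starProjection_eq_self_iff.2 (V.add_mem (hCV _) (hFV _))
      rw [← h2]
      have h3 : v - z • X v = 0 := by simpa using hv
      exact congrArg Subtype.val h3
    obtain ⟨u, hu⟩ := hz
    have h4 : (u : H →L[ℂ] H) (v : H) = 0 := by rw [hu]; simpa using h1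
    have h5 : ((↑u⁻¹ : H →L[ℂ] H) * u) (v : H) = 0 := by
      change (↑u⁻¹ : H →L[ℂ] H) ((u : H →L[ℂ] H) v) = 0
      rw [h4, map_zero]
    rw [Units.inv_mul] at h5
    exact Subtype.ext h5
  · intro z s hs hy
    have h1 := fd_det_pert (cmpr V CN) (cmpr V F) τ (cmpr_approx _ _ _ hτ) z s hs hy ?_
    · rw [hXs]
      refine h1.trans ?_
      have h2 := fd_detC_le f hf (fun j => c j) _ hCf z
      rw [← Finset.prod_range (fun j => ‖1 - z * (c j:ℂ)‖)] at h2
      gcongr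
      refine Finset.prod_nonneg fun i _ => ?_
      obtain ⟨G, _, hG⟩ := hτ i
      have : 0 ≤ τ i := (norm_nonneg _).trans hG
      positivity
    · intro v
      refine ⟨∑ j : Fin N, c j * ‖inner ℂ (f j) v‖ ^ 2, Finset.sum_nonneg fun j _ => mul_nonneg (hc _) (by positivity), ?_⟩
      rw [hCf, inner_sum]
      push_cast
      refine Finset.sum_congr rfl fun j _ => ?_
      rw [inner_smul_right, mul_assoc]
      congr 1
      rw [← inner_conj_symm v (f j)]
      exact RCLike.mul_conj _
  · have h1 := fd_trace_le _ _ (cmpr_approx V _ _ hτ)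
    have h2 : LinearMap.trace ℂ V (cmpr V CN) = ((∑ j ∈ Finset.range N, c j : ℝ) : ℂ) := by
      have : cmpr V CN = ∑ j : Fin N, (c j : ℂ) • (InnerProductSpace.rankOne ℂ (f j) (f j)).toLinearMap := by
        ext1 x
        rw [hCf]
        simp [mul_smul]
      rw [this, map_sum, Finset.sum_range]
      push_cast
      refine Finset.sum_congr rfl fun j _ => ?_
      rw [map_smul, InnerProductSpace.trace_rankOne, inner_self_eq_norm_sq_to_K, hf.1]
      simp
    rw [hXs, map_add, h2, Complex.add_re, Complex.ofReal_re]
    have h3 := (Complex.abs_re_le_norm _).trans h1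
    linarith [(abs_le.1 h3).1]
end Key

end PartP3

section PartP5


section Spec
variable {H : Type*} [NormedAddCommGroup H] [InnerProductSpace ℂ H] [CompleteSpace H]

open scoped ComplexOrder in
theorem exists_top_eigen (R : H →L[ℂ] H) (hc : IsCompactOperator R) (hp : R.IsPositive) (h0 : R ≠ 0) :
    ∃ v : H, ‖v‖ = 1 ∧ R v = (‖R‖ : ℂ) • v := by
  have : Nontrivial (H →L[ℂ] H) := ⟨R, 0, h0⟩
  obtain ⟨k, hk, hk2⟩ := spectrum.exists_nnnorm_eq_spectralRadius R
  rw [ContinuousLinearMap.spectralRadius_eq_nnnorm R hp.isSelfAdjoint] at hk2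
  have hk3 : ‖k‖ = ‖R‖ := congrArg NNReal.toReal (ENNReal.coe_injective hk2)
  have hk0 : k ≠ 0 := by
    rw [← norm_ne_zero_iff, hk3]
    exact norm_ne_zero_iff.2 h0
  obtain ⟨w, hw⟩ := ((IsCompactOperator.hasEigenvalue_iff_mem_spectrum hc hk0).2 hk).exists_hasEigenvector
  have hw1 : R w = k • w := hw.apply_eq_smul
  have hw0 : w ≠ 0 := hw.2
  have hwn : 0 < ‖w‖ := norm_pos_iff.2 hw0
  have h1 := hp.inner_nonneg_right w
  rw [hw1, inner_smul_right, inner_self_eq_norm_sq_to_K] at h1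
  have h2 : k = (‖R‖ : ℂ) := by
    have h3 : 0 ≤ k := by
      have h4 : (0:ℂ) ≤ (((‖w‖ ^ 2)⁻¹ : ℝ) : ℂ) := by
        rw [Complex.zero_le_real]; positivity
      have h5 := mul_nonneg h1 h4
      have h6 : k * ((‖w‖ : ℂ)) ^ 2 * (((‖w‖ ^ 2)⁻¹ : ℝ) : ℂ) = k := by
        have : (‖w‖ : ℂ) ≠ 0 := by exact_mod_cast hwn.ne'
        push_cast
        field_simp
      exact h5.trans_eq h6
    rw [← hk3]
    exact Complex.eq_coe_norm_of_nonneg h3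
  refine ⟨((‖w‖⁻¹ : ℝ) : ℂ) • w, ?_, ?_⟩
  · rw [norm_smul, Complex.norm_real, Real.norm_of_nonneg (by positivity)]
    field_simp
  · rw [map_smul, hw1, ← h2, smul_comm]

open scoped ComplexOrder in
theorem deflate (R : H →L[ℂ] H) (hc : IsCompactOperator R) (hp : R.IsPositive) (v : H) (hv : ‖v‖ = 1)
    (hRv : R v = (‖R‖ : ℂ) • v) :
    IsCompactOperator (R - (‖R‖ : ℂ) • InnerProductSpace.rankOne ℂ v v) ∧
    (R - (‖R‖ : ℂ) • InnerProductSpace.rankOne ℂ v v).IsPositive ∧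
    (R - (‖R‖ : ℂ) • InnerProductSpace.rankOne ℂ v v) v = 0 ∧
    ∀ x, R x = 0 → (R - (‖R‖ : ℂ) • InnerProductSpace.rankOne ℂ v v) x = 0 := by
  set R' := R - (‖R‖ : ℂ) • InnerProductSpace.rankOne ℂ v v with hR'
  have hvv : inner ℂ v v = (1:ℂ) := by rw [inner_self_eq_norm_sq_to_K, hv]; simp
  have happ : ∀ x, R' x = R x - ((‖R‖ : ℂ) * inner ℂ v x) • v := by
    intro x; simp [hR', mul_smul]
  set P : H →L[ℂ] H := 1 - InnerProductSpace.rankOne ℂ v v with hP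
  have hPx : ∀ x, P x = x - (inner ℂ v x : ℂ) • v := by intro x; simp [hP]
  have hRP : ∀ x, R' x = R (P x) := by
    intro x
    rw [happ, hPx, map_sub, map_smul, hRv, smul_smul, mul_comm]
  have hsym : ∀ x y, inner ℂ (R x) y = inner ℂ x (R y) := fun x y => hp.isSymmetric x y
  have hsym' : ∀ x, (inner ℂ (R x) v : ℂ) = (‖R‖ : ℂ) * inner ℂ x v := by
    intro x; rw [hsym, hRv, inner_smul_right]
  refine ⟨?_, ?_, ?_, ?_⟩
  · have : (⇑R' : H → H) = R ∘ P := funext hRP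
    rw [this]
    exact hc.comp_clm P
  · rw [ContinuousLinearMap.isPositive_iff]
    refine ⟨?_, ?_⟩
    · intro x y
      change inner ℂ (R' x) y = inner ℂ x (R' y)
      rw [happ, happ, inner_sub_left, inner_sub_right, hsym, inner_smul_left, inner_smul_right]
      congr 1
      simp
      ring
    · intro x
      have h1 : inner ℂ (R' x) x = inner ℂ (R (P x)) (P x) := by
        have hz : inner ℂ (R (P x)) v = (0:ℂ) := by
          rw [hsym', hPx, inner_sub_left, inner_smul_left, hvv]; simp
        have hx : P x + (inner ℂ v x : ℂ) • v = x := by rw [hPx]; abel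
        calc (inner ℂ (R' x) x : ℂ) = inner ℂ (R (P x)) (P x + (inner ℂ v x : ℂ) • v) := by rw [hx, hRP]
          _ = _ := by rw [inner_add_right, inner_smul_right, hz, mul_zero, add_zero]
      rw [h1]
      exact ((ContinuousLinearMap.isPositive_iff R).1 hp).2 _
  · rw [happ, hRv, hvv, mul_one, sub_self]
  · intro x hx
    rw [happ, hx, zero_sub, neg_eq_zero]
    have : (‖R‖ : ℂ) * inner ℂ v x = inner ℂ (R v) x := by
      rw [hRv, inner_smul_left]; simp
    rw [this, hsym, hx]
    simp

theorem partC_rank (e : ℕ → H) (c : ℕ → ℝ) (n : ℕ) :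
    Module.rank ℂ (LinearMap.range (partC e c n : H →ₗ[ℂ] H)) ≤ n := by
  classical
  have h1 : LinearMap.range (partC e c n : H →ₗ[ℂ] H) ≤
      Submodule.span ℂ (((Finset.range n).image e : Finset H) : Set H) := by
    rintro _ ⟨x, rfl⟩
    change partC e c n x ∈ _
    rw [partC_apply]
    refine Submodule.sum_mem _ fun j hj => Submodule.smul_mem _ _ (Submodule.subset_span ?_)
    exact_mod_cast Finset.mem_image_of_mem e hj
  refine (Submodule.rank_mono h1).trans ((rank_span_finset_le _).trans ?_)
  have := Finset.card_image_le (s := Finset.range n) (f := e)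
  rw [Finset.card_range] at this
  exact_mod_cast this

open Classical in
/-- chosen top eigenvector -/
noncomputable def topVec (R : H →L[ℂ] H) : H :=
  if h : ∃ v : H, ‖v‖ = 1 ∧ R v = (‖R‖ : ℂ) • v then h.choose else 0

/-- successive residuals -/
noncomputable def resid (C : H →L[ℂ] H) : ℕ → (H →L[ℂ] H)
  | 0 => C
  | n + 1 => resid C n - (‖resid C n‖ : ℂ) • InnerProductSpace.rankOne ℂ (topVec (resid C n)) (topVec (resid C n))

theorem resid_eq (C : H →L[ℂ] H) (n : ℕ) :
    resid C n = C - partC (fun k => topVec (resid C k)) (fun k => ‖resid C k‖) n := by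
  induction n with
  | zero => simp [resid, partC]
  | succ n ih =>
    rw [resid, partC, Finset.sum_range_succ]
    nth_rw 1 [ih]
    rw [partC]
    abel

theorem spectral_seq (C : H →L[ℂ] H) (hc : IsCompactOperator C) (hp : C.IsPositive)
    (hpos : ∀ n, 0 < sNum C (n + 1)) :
    ∃ (e : ℕ → H) (c : ℕ → ℝ), Orthonormal ℂ e ∧ (∀ j, C (e j) = (c j : ℂ) • e j) ∧
      (∀ j, c j = sNum C (j + 1)) ∧ ∀ j, ‖C - partC e c j‖ = c j := by
  set e : ℕ → H := fun k => topVec (resid C k) with he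
  set c : ℕ → ℝ := fun k => ‖resid C k‖ with hcdef
  have hne : ∀ n, resid C n ≠ 0 := by
    intro n h0
    have h1 := sNum_le C (partC e c n) n (partC_rank e c n)
    rw [← resid_eq, h0, norm_zero] at h1
    exact absurd (hpos n) (not_lt.2 h1)
  have hgood : ∀ n, IsCompactOperator (resid C n) ∧ (resid C n).IsPositive ∧ ‖e n‖ = 1 ∧
      resid C n (e n) = (c n : ℂ) • e n := by
    have htop : ∀ n, IsCompactOperator (resid C n) → (resid C n).IsPositive → ‖e n‖ = 1 ∧
      resid C n (e n) = (c n : ℂ) • e n := by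
      intro n h1 h2
      have h3 := exists_top_eigen _ h1 h2 (hne n)
      have h4 : e n = h3.choose := by simp only [he, topVec, dif_pos h3]
      rw [h4]
      exact h3.choose_spec
    intro n
    induction n with
    | zero => exact ⟨hc, hp, htop 0 hc hp⟩
    | succ n ih =>
      obtain ⟨h1, h2, h3, h4⟩ := ih
      obtain ⟨d1, d2, _, _⟩ := deflate _ h1 h2 (e n) h3 h4
      exact ⟨d1, d2, htop (n+1) d1 d2⟩
  have hkill : ∀ n m, n < m → resid C m (e n) = 0 := by
    intro n m h
    induction m, h using Nat.le_induction with
    | base =>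
      obtain ⟨h1, h2, h3, h4⟩ := hgood n
      exact (deflate _ h1 h2 (e n) h3 h4).2.2.1
    | succ m _ ih =>
      obtain ⟨h1, h2, h3, h4⟩ := hgood m
      exact (deflate _ h1 h2 (e m) h3 h4).2.2.2 _ ih
  have hcpos : ∀ n, 0 < c n := fun n => norm_pos_iff.2 (hne n)
  have horth1 : ∀ n m, n < m → inner ℂ (e m) (e n) = (0:ℂ) := by
    intro n m h
    obtain ⟨h1, h2, h3, h4⟩ := hgood m
    have h5 : (c m : ℂ) * inner ℂ (e m) (e n) = 0 := by
      have h6 : inner ℂ (resid C m (e m)) (e n) = inner ℂ (e m) (resid C m (e n)) := h2.isSymmetric _ _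
      rw [hkill n m h, h4, inner_smul_left, inner_zero_right] at h6
      simpa using h6
    have : (c m : ℂ) ≠ 0 := by exact_mod_cast (hcpos m).ne'
    exact (mul_eq_zero.1 h5).resolve_left this
  have horth : Orthonormal ℂ e := by
    refine ⟨fun n => (hgood n).2.2.1, ?_⟩
    intro i j hij
    rcases lt_or_gt_of_ne hij with h | h
    · rw [← inner_conj_symm, horth1 i j h]; simp
    · exact horth1 j i h
  have hCe : ∀ j, C (e j) = (c j : ℂ) • e j := by
    intro j
    have h1 := (hgood j).2.2.2
    rw [resid_eq C j] at h1
    rw [← h1, _root_.sub_apply, partC_apply, Finset.sum_eq_zero, sub_zero]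
    intro i hi
    change ((c i : ℂ) * inner ℂ (e i) (e j)) • e i = 0
    rw [horth.inner_eq_zero (Finset.mem_range.1 hi).ne]
    simp
  have hanti : Antitone c := by
    apply antitone_nat_of_succ_le
    intro n
    obtain ⟨h1, h2, h3, h4⟩ := hgood (n+1)
    have h5 : resid C (n+1) (e (n+1)) = resid C n (e (n+1)) := by
      rw [resid]
      change resid C n (e (n+1)) - ((‖resid C n‖ : ℂ) • (InnerProductSpace.rankOne ℂ (e n) (e n))) (e (n+1)) = _
      simp [horth.inner_eq_zero (show n ≠ n+1 by omega)]
    have h6 : c (n+1) = ‖resid C n (e (n+1))‖ := by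
      rw [← h5, h4, norm_smul, h3, mul_one, Complex.norm_real, Real.norm_of_nonneg (hcpos _).le]
    rw [h6]
    refine ((resid C n).le_opNorm _).trans ?_
    rw [h3, mul_one]
  have hres : ∀ j, ‖C - partC e c j‖ = c j := fun j => by rw [← resid_eq]
  refine ⟨e, c, horth, hCe, fun j => le_antisymm ?_ ?_, hres⟩
  · refine le_sNum C j _ fun F hF => ?_
    obtain ⟨a, ha, hFa⟩ := exists_comb_ker j (fun k : Fin (j+1) => e k) (F : H →ₗ[ℂ] H) hF
    set x := ∑ k, a k • e k with hx
    have horth' : Orthonormal ℂ (fun k : Fin (j+1) => e k) := horth.comp _ Fin.val_injective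
    have hnx : ‖x‖ ^ 2 = ∑ k, ‖a k‖ ^ 2 := by
      have := horth'.inner_sum a a Finset.univ
      have h7 : (inner ℂ x x : ℂ) = ((∑ k, ‖a k‖ ^ 2 : ℝ) : ℂ) := by
        rw [hx, this]
        push_cast
        exact Finset.sum_congr rfl fun k _ => RCLike.conj_mul _
      rw [inner_self_eq_norm_sq_to_K] at h7
      have h8 := congrArg Complex.re h7
      rw [Complex.ofReal_re] at h8
      rw [← h8]
      norm_cast
    have hCx : C x = ∑ k : Fin (j+1), ((c k : ℂ) * a k) • e k := by
      rw [hx, map_sum]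
      refine Finset.sum_congr rfl fun k _ => ?_
      rw [map_smul, hCe, smul_smul, mul_comm]
    have hnC : ‖C x‖ ^ 2 = ∑ k : Fin (j+1), (c k * ‖a k‖) ^ 2 := by
      have := horth'.inner_sum (fun k : Fin (j+1) => (c k : ℂ) * a k) (fun k : Fin (j+1) => (c k : ℂ) * a k) Finset.univ
      have h7 : (inner ℂ (C x) (C x) : ℂ) = ((∑ k : Fin (j+1), (c k * ‖a k‖) ^ 2 : ℝ) : ℂ) := by
        rw [hCx, this]
        push_cast
        refine Finset.sum_congr rfl fun k _ => ?_
        refine (RCLike.conj_mul _).trans ?_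
        rw [norm_mul, Complex.norm_real, Real.norm_of_nonneg (hcpos _).le]
        push_cast
        rfl
      rw [inner_self_eq_norm_sq_to_K] at h7
      have h8 := congrArg Complex.re h7
      rw [Complex.ofReal_re] at h8
      rw [← h8]
      norm_cast
    have hx0 : 0 < ‖x‖ := by
      obtain ⟨k, hk⟩ := Function.ne_iff.1 ha
      have h1 : 0 < ‖a k‖ ^ 2 := by
        have := norm_pos_iff.2 hk
        positivity
      have h2 : ‖a k‖ ^ 2 ≤ ∑ k, ‖a k‖ ^ 2 :=
        Finset.single_le_sum (f := fun k => ‖a k‖ ^ 2) (fun i _ => by positivity) (Finset.mem_univ k)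
      rw [← hnx] at h2
      by_contra h3
      have : ‖x‖ = 0 := le_antisymm (not_lt.1 h3) (norm_nonneg _)
      rw [this] at h2
      linarith
    have h9 : c j * ‖x‖ ≤ ‖C x‖ := by
      apply le_of_sq_le_sq _ (norm_nonneg _)
      rw [mul_pow, hnx, hnC, Finset.mul_sum]
      refine Finset.sum_le_sum fun k _ => ?_
      rw [mul_pow]
      gcongr
      · exact hanti (Nat.lt_succ_iff.1 k.2)
    have hF0 : F x = 0 := hFa
    have h10 : C x = (C - F) x := by rw [_root_.sub_apply, hF0, sub_zero]
    rw [h10] at h9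
    exact le_of_mul_le_mul_right (h9.trans ((C - F).le_opNorm x)) hx0
  · rw [← hres]
    exact sNum_le C _ j (partC_rank e c j)
end Spec

end PartP5

section PartP4


theorem exists_clog {f : ℂ → ℂ} {R : ℝ} (hR : 0 < R) (hf : Differentiable ℂ f) (h0 : f 0 = 1)
    (hne : ∀ z ∈ Metric.ball (0:ℂ) R, f z ≠ 0) :
    ∃ g : ℂ → ℂ, g 0 = 0 ∧ (∀ z ∈ Metric.ball (0:ℂ) R, HasDerivAt g (deriv f z / f z) z) ∧
      ∀ z ∈ Metric.ball (0:ℂ) R, f z = Complex.exp (g z) := by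
  have h1 : DifferentiableOn ℂ (fun z => deriv f z / f z) (Metric.ball 0 R) :=
    (hf.deriv.differentiableOn).div hf.differentiableOn hne
  obtain ⟨g, hg0, hg⟩ := h1.isExactOn_ball.with_val_at 0 0
  refine ⟨g, hg0, hg, fun z hz => ?_⟩
  have h2 : ∀ z ∈ Metric.ball (0:ℂ) R, HasDerivAt (fun z => f z * Complex.exp (-g z)) 0 z := by
    intro z hz
    have := (hf z).hasDerivAt.mul ((hg z hz).neg.cexp)
    have h4 : deriv f z * Complex.exp ((-g) z) + f z * (Complex.exp ((-g) z) * -(deriv f z / f z)) = 0 := by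
      have := hne z hz
      field_simp
      ring
    rw [h4] at this
    exact this
  have h3 := (Metric.isOpen_ball (x := (0:ℂ)) (ε := R)).is_const_of_deriv_eq_zero
    (convex_ball (0:ℂ) R).isPreconnected (f := fun z => f z * Complex.exp (-g z))
    (fun z hz => (h2 z hz).differentiableAt.differentiableWithinAt)
    (fun z hz => (h2 z hz).deriv) hz (Metric.mem_ball_self hR)
  simp only [h0, hg0, neg_zero, Complex.exp_zero, mul_one] at h3
  rw [Complex.exp_neg] at h3
  have := Complex.exp_ne_zero (g z)
  field_simp at h3
  exact h3

theorem clog1 {f : ℂ → ℂ} {R M : ℝ} (hR : 0 < R) (hM : 0 < M) (hf : Differentiable ℂ f) (h0 : f 0 = 1)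
    (hne : ∀ z ∈ Metric.ball (0:ℂ) R, f z ≠ 0)
    (hb : ∀ z ∈ Metric.ball (0:ℂ) R, ‖f z‖ ≤ Real.exp M) {z : ℂ} (hz : ‖z‖ ≤ R / 2) :
    Real.exp (-(4 * M * ‖z‖ / R)) ≤ ‖f z‖ := by
  obtain ⟨g, hg0, hg, hgf⟩ := exists_clog hR hf h0 hne
  have hzb : z ∈ Metric.ball (0:ℂ) R := by
    rw [mem_ball_zero_iff]; linarith
  have h1 := Complex.borelCaratheodory_zero hM
    (fun w hw => (hg w hw).differentiableAt.differentiableWithinAt)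
    (fun w hw => by
      have := hb w hw
      rw [hgf w hw, Complex.norm_exp] at this
      exact Real.exp_le_exp.1 this) hR hzb hg0
  rw [hgf z hzb, Complex.norm_exp]
  apply Real.exp_le_exp.2
  have h2 := (abs_le.1 ((Complex.abs_re_le_norm _).trans h1)).1
  refine le_trans (neg_le_neg ?_) h2
  rw [div_le_div_iff₀ (by linarith) hR]
  have : 0 ≤ M * ‖z‖ := by positivity
  nlinarith

theorem clog2 {f : ℂ → ℂ} {R M : ℝ} (hR : 0 < R) (hM : 0 < M) (hf : Differentiable ℂ f) (h0 : f 0 = 1)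
    (hd : HasDerivAt f 0 0)
    (hne : ∀ z ∈ Metric.ball (0:ℂ) R, f z ≠ 0)
    (hb : ∀ z ∈ Metric.ball (0:ℂ) R, ‖f z‖ ≤ Real.exp M) {z : ℂ} (hz : ‖z‖ ≤ R / 4) :
    Real.exp (-(32 * M * ‖z‖ ^ 2 / R ^ 2)) ≤ ‖f z‖ := by
  obtain ⟨g, hg0, hg, hgf⟩ := exists_clog hR hf h0 hne
  have hdiff : DifferentiableOn ℂ g (Metric.ball 0 R) :=
    fun w hw => (hg w hw).differentiableAt.differentiableWithinAt
  have hzb : z ∈ Metric.ball (0:ℂ) R := by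
    rw [mem_ball_zero_iff]; linarith
  have h1 : ∀ w ∈ Metric.ball (0:ℂ) R, ‖g w‖ ≤ 2 * M * ‖w‖ / (R - ‖w‖) := fun w hw =>
    Complex.borelCaratheodory_zero hM hdiff
    (fun w hw => by
      have := hb w hw
      rw [hgf w hw, Complex.norm_exp] at this
      exact Real.exp_le_exp.1 this) hR hw hg0
  set h := dslope g 0 with hh
  have hh0 : h 0 = 0 := by
    rw [hh, dslope_same, (hg 0 (Metric.mem_ball_self hR)).deriv, hd.deriv, zero_div]
  have hgh : ∀ w, g w = w * h w := by
    intro w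
    have := sub_smul_dslope g 0 w
    rw [hg0] at this
    simpa using this.symm
  have hhd : DifferentiableOn ℂ h (Metric.ball 0 (R/2)) :=
    ((Complex.differentiableOn_dslope (Metric.ball_mem_nhds 0 hR)).2 hdiff).mono
      (Metric.ball_subset_ball (by linarith))
  have hhb : ∀ w ∈ Metric.ball (0:ℂ) (R/2), ‖h w‖ ≤ 4 * M / R := by
    intro w hw
    rw [mem_ball_zero_iff] at hw
    by_cases hw0 : w = 0
    · rw [hw0, hh0, norm_zero]; positivity
    have hw1 : 0 < ‖w‖ := norm_pos_iff.2 hw0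
    have h2 := h1 w (by rw [mem_ball_zero_iff]; linarith)
    rw [hgh, norm_mul, le_div_iff₀ (by linarith)] at h2
    rw [le_div_iff₀ hR]
    have h3 : ‖h w‖ * (R - ‖w‖) ≤ 2 * M := by
      have : ‖w‖ * (‖h w‖ * (R - ‖w‖)) ≤ ‖w‖ * (2 * M) := by nlinarith
      exact le_of_mul_le_mul_left this hw1
    nlinarith [norm_nonneg (h w)]
  have h4 := Complex.borelCaratheodory_zero (M := 4 * M / R) (z := z) (R := R/2) (by positivity) hhd
    (fun w hw => (Complex.re_le_norm _).trans (hhb w hw)) (by positivity)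
    (by rw [mem_ball_zero_iff]; linarith) hh0
  have h5 : ‖h z‖ ≤ 32 * M * ‖z‖ / R ^ 2 := by
    refine h4.trans ?_
    rw [div_le_div_iff₀ (by linarith) (by positivity)]
    have : 2 * (4 * M / R) * ‖z‖ * R ^ 2 = 8 * (M * ‖z‖) * R := by field_simp; ring
    rw [this]
    have : 0 ≤ M * ‖z‖ := by positivity
    nlinarith
  rw [hgf z hzb, Complex.norm_exp]
  apply Real.exp_le_exp.2
  have h6 : ‖g z‖ ≤ 32 * M * ‖z‖ ^ 2 / R ^ 2 := by
    rw [hgh, norm_mul]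
    calc _ ≤ ‖z‖ * (32 * M * ‖z‖ / R ^ 2) := by gcongr
      _ = _ := by ring
  exact (abs_le.1 ((Complex.abs_re_le_norm _).trans h6)).1

end PartP4

section PartP6


section Lim
variable {H : Type*} [NormedAddCommGroup H] [InnerProductSpace ℂ H]

theorem opApprox_seq (X : H →L[ℂ] H) (Y : ℕ → H →L[ℂ] H) (ρ : ℕ → ℝ) (hρ : Antitone ρ)
    (hr : ∀ n, Module.rank ℂ (LinearMap.range (Y n : H →ₗ[ℂ] H)) ≤ n) (hY : ∀ n, ‖X - Y n‖ ≤ ρ n)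
    (N : ℕ) : opApprox (Y N) (fun i => 2 * ρ i) := by
  have h0 : ∀ i, 0 ≤ ρ i := fun i => (norm_nonneg _).trans (hY i)
  intro j
  rcases le_total j N with h | h
  · refine ⟨Y j, hr j, ?_⟩
    have : Y N - Y j = (X - Y j) - (X - Y N) := by abel
    rw [this]
    refine (norm_sub_le _ _).trans ?_
    have := hρ h
    have := hY j
    have := hY N
    linarith
  · refine ⟨Y N, (hr N).trans (by exact_mod_cast h), ?_⟩
    have := h0 j
    simp only [sub_self, norm_zero]
    linarith

theorem opApprox_add (X Y : H →L[ℂ] H) (ρ τ : ℕ → ℝ) (hX : opApprox X ρ) (hY : opApprox Y τ) :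
    opApprox (X + Y) (fun i => ρ (i/2) + τ (i/2)) := by
  intro j
  obtain ⟨F, hF, hF'⟩ := hX (j/2)
  obtain ⟨G, hG, hG'⟩ := hY (j/2)
  refine ⟨F + G, (rank_add_le' F G _ _ hF hG).trans ?_, ?_⟩
  · have : j/2 + j/2 ≤ j := by omega
    exact_mod_cast this
  · have : X + Y - (F + G) = (X - F) + (Y - G) := by abel
    rw [this]
    exact (norm_add_le _ _).trans (add_le_add hF' hG')

variable [CompleteSpace H]

theorem eventually_unit (A : H →L[ℂ] H) (hA : ∀ z : ℂ, IsUnit (1 - z • A)) (B : ℕ → H →L[ℂ] H)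
    (hB : Tendsto B atTop (𝓝 A)) (r : ℝ) :
    ∀ᶠ N in atTop, ∀ z ∈ Metric.closedBall (0:ℂ) r, IsUnit (1 - z • B N) := by
  have h1 : ∀ᶠ X in 𝓝 A, ∀ z ∈ Metric.closedBall (0:ℂ) r, IsUnit (1 - z • X) := by
    apply (isCompact_closedBall (0:ℂ) r).eventually_forall_of_forall_eventually
    intro z _
    have hcont : Continuous (fun p : (H →L[ℂ] H) × ℂ => 1 - p.2 • p.1) := by fun_prop
    exact (Units.isOpen.preimage hcont).mem_nhds (hA z)
  exact hB.eventually h1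

theorem approx_dets (e : ℕ → H) (he : Orthonormal ℂ e) (c τ : ℕ → ℝ) (hc : Antitone c) (hτ : Antitone τ)
    (hc0 : Tendsto c atTop (𝓝 0)) (hτ0 : Tendsto τ atTop (𝓝 0))
    (C T A : H →L[ℂ] H) (hA : A = C + T) (hC : ∀ j, ‖C - partC e c j‖ ≤ c j)
    (hT : opApprox T τ) (hunit : ∀ z : ℂ, IsUnit (1 - z • A)) :
    ∃ (d : ℕ → ℕ) (t : ℕ → ℂ) (D : ℕ → ℂ → ℂ), (∀ N, Differentiable ℂ (D N)) ∧ (∀ N, D N 0 = 1) ∧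
      (∀ N, HasDerivAt (D N) (-t N) 0) ∧
      (∀ r : ℝ, ∀ᶠ N in atTop, ∀ z ∈ Metric.ball (0:ℂ) r, D N z ≠ 0) ∧
      (∀ N z, ‖D N z‖ ≤ ∏ i ∈ Finset.range (d N), (1 + ‖z‖ * (2 * c (i/2) + 2 * τ (i/2)))) ∧
      (∀ N z, ‖D N z * Complex.exp (z * t N)‖ ≤
        Real.exp (2 * ‖z‖ ^ (3/2 : ℝ) * ∑ i ∈ Finset.range (d N), (2 * c (i/2) + 2 * τ (i/2)) ^ (3/2 : ℝ))) ∧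
      (∀ N (z : ℂ) (s : ℝ), 0 < s → (∀ y : ℝ, 0 ≤ y → s ≤ ‖1 - z * y‖) →
        ‖D N z‖ ≤ (∏ j ∈ Finset.range N, ‖1 - z * c j‖) *
          ∏ i ∈ Finset.range (d N), (1 + ‖z‖ * (2 * τ i / s))) ∧
      ∀ N, (∑ j ∈ Finset.range N, c j) - ∑ i ∈ Finset.range (d N), 2 * τ i ≤ (t N).re := by
  have hcn : ∀ j, 0 ≤ c j := fun j => (norm_nonneg _).trans (hC j)
  choose F hF1 hF2 using hT
  have hFfin : ∀ n, FiniteDimensional ℂ (LinearMap.range (F n : H →ₗ[ℂ] H)) := fun n =>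
    Module.rank_lt_aleph0_iff.1 ((hF1 n).trans_lt (Cardinal.natCast_lt_aleph0))
  have hτF : ∀ N, opApprox (F N) (fun i => 2 * τ i) := opApprox_seq T F τ hτ hF1 hF2
  have hCN : ∀ N, opApprox (partC e c N) (fun i => 2 * c i) :=
    opApprox_seq C _ c hc (partC_rank e c) hC
  have hsum : ∀ N, opApprox (partC e c N + F N) (fun i => 2 * c (i/2) + 2 * τ (i/2)) := fun N =>
    opApprox_add _ _ _ _ (hCN N) (hτF N)
  have hlim : Tendsto (fun N => partC e c N + F N) atTop (𝓝 A) := by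
    rw [hA]
    apply Tendsto.add
    · rw [tendsto_iff_norm_sub_tendsto_zero]
      exact squeeze_zero (fun _ => norm_nonneg _) (fun N => by rw [norm_sub_rev]; exact hC N) hc0
    · rw [tendsto_iff_norm_sub_tendsto_zero]
      exact squeeze_zero (fun _ => norm_nonneg _) (fun N => by rw [norm_sub_rev]; exact hF2 N) hτ0
  choose d t D h using fun N => key_det e he c hcn N (F N) (hFfin N) _ _ (hτF N) (hsum N)
  refine ⟨d, t, D, fun N => (h N).1, fun N => (h N).2.1, fun N => (h N).2.2.1, ?_,
    fun N => (h N).2.2.2.2.1, fun N => (h N).2.2.2.2.2.1, fun N => (h N).2.2.2.2.2.2.1,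
    fun N => (h N).2.2.2.2.2.2.2⟩
  intro r
  filter_upwards [eventually_unit A hunit _ hlim r] with N hN z hz
  exact (h N).2.2.2.1 z (hN z (Metric.ball_subset_closedBall hz))

theorem log_one_add_le_rpow {y δ : ℝ} (hy : 0 ≤ y) (hδ : 0 < δ) (hδ1 : δ ≤ 1) :
    Real.log (1 + y) ≤ y ^ δ / δ := by
  have h1 : Real.log ((1 + y) ^ δ) = δ * Real.log (1 + y) := Real.log_rpow (by linarith) _
  have h2 := Real.log_le_sub_one_of_pos (Real.rpow_pos_of_pos (show 0 < 1 + y by linarith) δ)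
  have h3 := Real.rpow_add_le_add_rpow zero_le_one hy hδ.le hδ1
  rw [Real.one_rpow] at h3
  rw [le_div_iff₀ hδ]
  nlinarith

theorem prod_le_exp (n : ℕ) (f g : ℕ → ℝ) (hf : ∀ i, 0 ≤ f i) (hfg : ∀ i, Real.log (1 + f i) ≤ g i)
    (hg : Summable g) : ∏ i ∈ Finset.range n, (1 + f i) ≤ Real.exp (∑' i, g i) := by
  have hg0 : ∀ i, 0 ≤ g i := fun i => (Real.log_nonneg (by linarith [hf i])).trans (hfg i)
  calc ∏ i ∈ Finset.range n, (1 + f i) ≤ ∏ i ∈ Finset.range n, Real.exp (g i) := by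
        apply Finset.prod_le_prod
        · intro i _; linarith [hf i]
        · intro i _
          rw [← Real.log_le_iff_le_exp (by linarith [hf i])]
          exact hfg i
    _ = Real.exp (∑ i ∈ Finset.range n, g i) := by rw [Real.exp_sum]
    _ ≤ _ := Real.exp_le_exp.2 (hg.sum_le_tsum _ fun i _ => hg0 i)

theorem limit_core (e : ℕ → H) (he : Orthonormal ℂ e) (c τ : ℕ → ℝ) (hc : Antitone c) (hτ : Antitone τ)
    (hc0 : Tendsto c atTop (𝓝 0)) (hτ0 : Tendsto τ atTop (𝓝 0)) (hτn : ∀ i, 0 ≤ τ i)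
    (C T A : H →L[ℂ] H) (hA : A = C + T) (hC : ∀ j, ‖C - partC e c j‖ ≤ c j)
    (hT : opApprox T τ) (hunit : ∀ z : ℂ, IsUnit (1 - z • A))
    (δ : ℝ) (hδ : 0 < δ) (hδ1 : δ < 1)
    (hs : Summable (fun i => (2 * c (i/2) + 2 * τ (i/2)) ^ δ)) (hsτ : Summable τ)
    (z : ℂ) (s : ℝ) (hs0 : 0 < s) (hzs : ∀ y : ℝ, 0 ≤ y → s ≤ ‖1 - z * y‖)
    (hL : Summable (fun j => Real.log ‖1 - z * c j‖)) :
    0 ≤ ∑' j, Real.log ‖1 - z * c j‖ + ∑' i, Real.log (1 + ‖z‖ * (2 * τ i / s)) := by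
  obtain ⟨d, t, D, h1, h2, h3, h4, h5, h6, h7, h8⟩ :=
    approx_dets e he c τ hc hτ hc0 hτ0 C T A hA hC hT hunit
  have hcn : ∀ j, 0 ≤ c j := fun j => (norm_nonneg _).trans (hC j)
  set σ : ℕ → ℝ := fun i => 2 * c (i/2) + 2 * τ (i/2) with hσ
  have hσn : ∀ i, 0 ≤ σ i := fun i => by
    have := hcn (i/2); have := hτn (i/2); simp only [hσ]; linarith
  have hsl : Summable (fun i => Real.log (1 + ‖z‖ * (2 * τ i / s))) := by
    refine Summable.of_nonneg_of_le (fun i => Real.log_nonneg ?_) (fun i => ?_)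
      ((hsτ.mul_left (‖z‖ * 2 / s)))
    · have := hτn i
      have : 0 ≤ ‖z‖ * (2 * τ i / s) := by positivity
      linarith
    · have := hτn i
      have h0 : 0 ≤ ‖z‖ * (2 * τ i / s) := by positivity
      refine (Real.log_le_sub_one_of_pos (by linarith)).trans (le_of_eq ?_)
      ring
  set Kc := (∑' i, σ i ^ δ) / δ + 1 with hKc
  have hsn : 0 ≤ ∑' i, σ i ^ δ := tsum_nonneg fun i => Real.rpow_nonneg (hσn i) _
  have hKc0 : 0 < Kc := by positivity
  have hgrow : ∀ N w, ‖D N w‖ ≤ Real.exp (‖w‖ ^ δ * (∑' i, σ i ^ δ) / δ) := by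
    intro N w
    refine (h5 N w).trans ?_
    have := prod_le_exp (d N) (fun i => ‖w‖ * σ i) (fun i => ‖w‖ ^ δ / δ * σ i ^ δ)
      (fun i => mul_nonneg (norm_nonneg _) (hσn i)) (fun i => by
        refine (log_one_add_le_rpow (mul_nonneg (norm_nonneg _) (hσn i)) hδ hδ1.le).trans (le_of_eq ?_)
        rw [Real.mul_rpow (norm_nonneg _) (hσn i)]; ring) (hs.mul_left _)
    refine this.trans (le_of_eq ?_)
    rw [tsum_mul_left]; congr 1; ring
  -- lower bound
  have hlow : ∀ R : ℝ, 0 < R → ‖z‖ ≤ R / 2 → ∀ᶠ N in atTop,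
      -(4 * (Kc * R ^ δ) * ‖z‖ / R) ≤ Real.log ‖D N z‖ ∧ 0 < ‖D N z‖ := by
    intro R hR hzR
    filter_upwards [h4 R] with N hN
    have hb : ∀ w ∈ Metric.ball (0:ℂ) R, ‖D N w‖ ≤ Real.exp (Kc * R ^ δ) := by
      intro w hw
      rw [mem_ball_zero_iff] at hw
      refine (hgrow N w).trans (Real.exp_le_exp.2 ?_)
      have h9 : ‖w‖ ^ δ ≤ R ^ δ := Real.rpow_le_rpow (norm_nonneg _) hw.le hδ.le
      have h10 : 0 ≤ R ^ δ := Real.rpow_nonneg hR.le _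
      rw [hKc, mul_div_assoc]
      have h11 : 0 ≤ (∑' i, σ i ^ δ) / δ := by positivity
      nlinarith
    have h12 := clog1 hR (mul_pos hKc0 (Real.rpow_pos_of_pos hR δ)) (h1 N) (h2 N) hN hb hzR
    have h13 : 0 < ‖D N z‖ := lt_of_lt_of_le (Real.exp_pos _) h12
    exact ⟨(Real.le_log_iff_exp_le h13).2 h12, h13⟩
  have hpos : ∀ j, 0 < ‖1 - z * c j‖ := fun j => hs0.trans_le (hzs _ (hcn j))
  have hup : ∀ N, 0 < ‖D N z‖ → Real.log ‖D N z‖ ≤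
      ∑ j ∈ Finset.range N, Real.log ‖1 - z * c j‖ + ∑' i, Real.log (1 + ‖z‖ * (2 * τ i / s)) := by
    intro N hN
    rw [Real.log_le_iff_le_exp hN, Real.exp_add, Real.exp_sum]
    refine (h7 N z s hs0 hzs).trans ?_
    gcongr with j hj
    · refine Finset.prod_nonneg fun i _ => ?_
      have := hτn i; positivity
    · exact (Real.exp_log (hpos _)).ge
    · exact prod_le_exp (d N) (fun i => ‖z‖ * (2 * τ i / s)) _ (fun i => by
        have := hτn i; positivity) (fun i => le_rfl) hsl
  have hR : ∀ R : ℝ, 0 < R → ‖z‖ ≤ R / 2 → -(4 * (Kc * R ^ δ) * ‖z‖ / R) ≤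
      ∑' j, Real.log ‖1 - z * c j‖ + ∑' i, Real.log (1 + ‖z‖ * (2 * τ i / s)) := by
    intro R hR hzR
    have ht := (hL.hasSum.tendsto_sum_nat).add_const (∑' i, Real.log (1 + ‖z‖ * (2 * τ i / s)))
    refine ge_of_tendsto ht ?_
    filter_upwards [hlow R hR hzR] with N hN
    exact hN.1.trans (hup N hN.2)
  have hlim : Tendsto (fun R : ℝ => -(4 * Kc * ‖z‖ * R ^ (-(1 - δ)))) atTop (𝓝 (-(4 * Kc * ‖z‖ * 0))) :=
    ((tendsto_rpow_neg_atTop (by linarith)).const_mul _).neg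
  rw [mul_zero, neg_zero] at hlim
  refine le_of_tendsto hlim ?_
  filter_upwards [eventually_gt_atTop 0, eventually_ge_atTop (2 * ‖z‖)] with R h0 h1
  refine le_trans (le_of_eq ?_) (hR R h0 (by linarith))
  have : R ^ (-(1 - δ)) = R ^ δ / R := by
    rw [neg_sub, Real.rpow_sub h0, Real.rpow_one]
  rw [this]
  ring

theorem limit_one (e : ℕ → H) (he : Orthonormal ℂ e) (c τ : ℕ → ℝ) (hc : Antitone c) (hτ : Antitone τ)
    (hc0 : Tendsto c atTop (𝓝 0)) (hτ0 : Tendsto τ atTop (𝓝 0)) (hτn : ∀ i, 0 ≤ τ i)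
    (C T A : H →L[ℂ] H) (hA : A = C + T) (hC : ∀ j, ‖C - partC e c j‖ ≤ c j)
    (hT : opApprox T τ) (hunit : ∀ z : ℂ, IsUnit (1 - z • A))
    (hs : Summable (fun i => (2 * c (i/2) + 2 * τ (i/2)) ^ (3/2 : ℝ))) (hsτ : Summable τ)
    (x : ℝ) (hx : 0 < x) (J : ℕ) :
    0 ≤ ∑ j ∈ Finset.range J, (Real.log (1 + x * c j) - x * c j) + 4 * x * ∑' i, τ i := by
  obtain ⟨d, t, D, h1, h2, h3, h4, h5, h6, h7, h8⟩ :=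
    approx_dets e he c τ hc hτ hc0 hτ0 C T A hA hC hT hunit
  have hcn : ∀ j, 0 ≤ c j := fun j => (norm_nonneg _).trans (hC j)
  set σ : ℕ → ℝ := fun i => 2 * c (i/2) + 2 * τ (i/2) with hσ
  have hσn : ∀ i, 0 ≤ σ i := fun i => by
    have := hcn (i/2); have := hτn (i/2); simp only [hσ]; linarith
  set S := ∑' i, σ i ^ (3/2 : ℝ)
  have hsn : 0 ≤ S := tsum_nonneg fun i => Real.rpow_nonneg (hσn i) _
  set f : ℕ → ℂ → ℂ := fun N w => D N w * Complex.exp (w * t N) with hf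
  have hfd : ∀ N, Differentiable ℂ (f N) := fun N => by
    have := h1 N
    simp only [hf]
    fun_prop
  have hf0 : ∀ N, f N 0 = 1 := fun N => by simp [hf, h2]
  have hfd0 : ∀ N, HasDerivAt (f N) 0 0 := by
    intro N
    have h9 : HasDerivAt (fun w : ℂ => Complex.exp (w * t N)) (Complex.exp (0 * t N) * (1 * t N)) 0 :=
      ((hasDerivAt_id (0:ℂ)).mul_const (t N)).cexp
    have h10 := (h3 N).mul h9
    have h11 : -t N * Complex.exp (0 * t N) + D N 0 * (Complex.exp (0 * t N) * (1 * t N)) = 0 := by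
      rw [h2]; simp
    rw [h11] at h10
    exact h10
  have hz : ‖(-x : ℂ)‖ = x := by rw [norm_neg, Complex.norm_real, Real.norm_of_nonneg hx.le]
  have hlow : ∀ R : ℝ, 0 < R → x ≤ R / 4 → ∀ᶠ N in atTop,
      Real.exp (-(32 * ((2 * S + 1) * R ^ (3/2 : ℝ)) * x ^ 2 / R ^ 2)) ≤ ‖f N (-x)‖ := by
    intro R hR hxR
    filter_upwards [h4 R] with N hN
    have hb : ∀ w ∈ Metric.ball (0:ℂ) R, ‖f N w‖ ≤ Real.exp ((2 * S + 1) * R ^ (3/2 : ℝ)) := by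
      intro w hw
      rw [mem_ball_zero_iff] at hw
      refine (h6 N w).trans (Real.exp_le_exp.2 ?_)
      have h9 : ‖w‖ ^ (3/2 : ℝ) ≤ R ^ (3/2 : ℝ) := Real.rpow_le_rpow (norm_nonneg _) hw.le (by norm_num)
      have h10 : 0 ≤ ‖w‖ ^ (3/2 : ℝ) := Real.rpow_nonneg (norm_nonneg _) _
      have h11 : ∑ i ∈ Finset.range (d N), σ i ^ (3/2 : ℝ) ≤ S :=
        hs.sum_le_tsum _ fun i _ => Real.rpow_nonneg (hσn i) _
      calc _ ≤ 2 * R ^ (3/2 : ℝ) * S := by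
            have : 0 ≤ ∑ i ∈ Finset.range (d N), σ i ^ (3/2 : ℝ) :=
              Finset.sum_nonneg fun i _ => Real.rpow_nonneg (hσn i) _
            gcongr
        _ ≤ _ := by nlinarith
    have hne : ∀ w ∈ Metric.ball (0:ℂ) R, f N w ≠ 0 := fun w hw =>
      mul_ne_zero (hN w hw) (Complex.exp_ne_zero _)
    have h12 := clog2 (z := -x) hR (mul_pos (by linarith) (Real.rpow_pos_of_pos hR _)) (hfd N) (hf0 N) (hfd0 N) hne hb
      (by rw [hz]; exact hxR)
    rw [hz] at h12
    exact h12
  have hlogle : ∀ y : ℝ, 0 ≤ y → Real.log (1 + y) ≤ y := fun y hy => by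
    have := Real.log_le_sub_one_of_pos (show 0 < 1 + y by linarith)
    linarith
  have hup : ∀ N, J ≤ N → ‖f N (-x)‖ ≤
      Real.exp (∑ j ∈ Finset.range J, (Real.log (1 + x * c j) - x * c j) + 4 * x * ∑' i, τ i) := by
    intro N hN
    have h9 := h7 N (-x) 1 one_pos (fun y hy => by
      have : (1:ℂ) - -x * y = ((1 + x * y : ℝ) : ℂ) := by push_cast; ring
      rw [this, Complex.norm_real, Real.norm_of_nonneg (by positivity)]
      have : 0 ≤ x * y := by positivity
      linarith)
    have h10 : ∏ i ∈ Finset.range (d N), (1 + ‖(-x : ℂ)‖ * (2 * τ i / 1)) ≤ Real.exp (2 * x * ∑' i, τ i) := by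
      rw [← tsum_mul_left]
      refine prod_le_exp (d N) _ _ (fun i => ?_) (fun i => ?_) (hsτ.mul_left (2 * x))
      · have := hτn i; positivity
      · have := hτn i
        refine (hlogle _ (by positivity)).trans (le_of_eq ?_)
        rw [hz]; ring
    have h11 : ∏ j ∈ Finset.range N, ‖1 - (-x : ℂ) * c j‖ =
        Real.exp (∑ j ∈ Finset.range N, Real.log (1 + x * c j)) := by
      rw [Real.exp_sum]
      refine Finset.prod_congr rfl fun j _ => ?_
      have h0 : 0 ≤ x * c j := mul_nonneg hx.le (hcn j)
      have : (1:ℂ) - -x * c j = ((1 + x * c j : ℝ) : ℂ) := by push_cast; ring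
      rw [this, Complex.norm_real, Real.norm_of_nonneg (by linarith), Real.exp_log (by linarith)]
    rw [h11] at h9
    have h12 : ‖Complex.exp (-x * t N)‖ ≤ Real.exp (-x * ∑ j ∈ Finset.range N, c j + 2 * x * ∑' i, τ i) := by
      rw [Complex.norm_exp]
      apply Real.exp_le_exp.2
      have h13 : (-x * t N : ℂ).re = - x * (t N).re := by simp
      rw [h13]
      have h14 := h8 N
      have h15 : ∑ i ∈ Finset.range (d N), 2 * τ i ≤ 2 * ∑' i, τ i := by
        rw [← Finset.mul_sum]
        have := hsτ.sum_le_tsum (Finset.range (d N)) fun i _ => hτn i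
        linarith
      nlinarith
    have h16 : ∑ j ∈ Finset.range N, Real.log (1 + x * c j) - x * ∑ j ∈ Finset.range N, c j ≤
        ∑ j ∈ Finset.range J, (Real.log (1 + x * c j) - x * c j) := by
      rw [Finset.mul_sum, ← Finset.sum_sub_distrib]
      apply Finset.sum_le_sum_of_subset_of_nonpos'
      · exact Finset.range_mono hN
      · intro j _ _
        have := hlogle _ (mul_nonneg hx.le (hcn j))
        linarith
    calc ‖f N (-x)‖ = ‖D N (-x)‖ * ‖Complex.exp (-x * t N)‖ := norm_mul _ _
      _ ≤ (Real.exp (∑ j ∈ Finset.range N, Real.log (1 + x * c j)) * Real.exp (2 * x * ∑' i, τ i)) *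
          Real.exp (-x * ∑ j ∈ Finset.range N, c j + 2 * x * ∑' i, τ i) := by
          gcongr
          exact h9.trans (by gcongr)
      _ = Real.exp (∑ j ∈ Finset.range N, Real.log (1 + x * c j) - x * ∑ j ∈ Finset.range N, c j + 4 * x * ∑' i, τ i) := by
          rw [← Real.exp_add, ← Real.exp_add]; congr 1; ring
      _ ≤ _ := by
          apply Real.exp_le_exp.2
          linarith
  have hR : ∀ R : ℝ, 0 < R → x ≤ R / 4 → -(32 * ((2 * S + 1) * R ^ (3/2 : ℝ)) * x ^ 2 / R ^ 2) ≤
      ∑ j ∈ Finset.range J, (Real.log (1 + x * c j) - x * c j) + 4 * x * ∑' i, τ i := by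
    intro R hR hxR
    obtain ⟨N, hN, hJ⟩ := ((hlow R hR hxR).and (eventually_ge_atTop J)).exists
    exact Real.exp_le_exp.1 (hN.trans (hup N hJ))
  have hlim : Tendsto (fun R : ℝ => -(32 * (2 * S + 1) * x ^ 2 * R ^ (-(1/2 : ℝ)))) atTop
      (𝓝 (-(32 * (2 * S + 1) * x ^ 2 * 0))) :=
    ((tendsto_rpow_neg_atTop (by norm_num)).const_mul _).neg
  rw [mul_zero, neg_zero] at hlim
  refine le_of_tendsto hlim ?_
  filter_upwards [eventually_gt_atTop 0, eventually_ge_atTop (4 * x)] with R h0 h1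
  refine le_trans (le_of_eq ?_) (hR R h0 (by linarith))
  have : R ^ (-(1/2 : ℝ)) = R ^ (3/2 : ℝ) / R ^ 2 := by
    rw [← Real.rpow_natCast, ← Real.rpow_sub h0]
    norm_num
  rw [this]
  ring
end Lim

end PartP6

section PartP7

open MeasureTheory

/-- `log |1 - w y|` for a unimodular `w` with `2 Re w = 2 - k` -/
noncomputable def ell (k y : ℝ) : ℝ := (1/2) * Real.log ((1 - y)^2 + k * y)

theorem ell_pos {k y : ℝ} (hk : 0 < k) (hy : 0 ≤ y) : 0 < (1 - y)^2 + k * y := by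
  rcases hy.eq_or_lt with h | h
  · rw [← h]; norm_num
  · have : 0 < k * y := mul_pos hk h
    positivity

theorem ell_nonpos {k y : ℝ} (hk : 0 < k) (hk1 : k ≤ 1) (hy : 0 ≤ y) (hy1 : y ≤ 1) : ell k y ≤ 0 := by
  unfold ell
  have := Real.log_nonpos (ell_pos hk hy).le (by nlinarith)
  linarith

theorem ell_inv {k y : ℝ} (hk : 0 < k) (hy : 0 < y) : ell k y⁻¹ = ell k y - Real.log y := by
  unfold ell
  have h1 : (1 - y⁻¹)^2 + k * y⁻¹ = ((1 - y)^2 + k * y) / y ^ 2 := by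
    field_simp; ring
  rw [h1, Real.log_div (ell_pos hk hy.le).ne' (by positivity), Real.log_pow]
  push_cast; ring

theorem ell_abs {k : ℝ} (hk : 0 < k) (hk1 : k ≤ 1) :
    ∃ K : ℝ, 0 < K ∧ ∀ y, 0 ≤ y → |ell k y| ≤ K * Real.log (1 + y) := by
  have hs : 0 < k - k^2/4 := by nlinarith
  refine ⟨3 / (k - k^2/4) + 1, by positivity, fun y hy => ?_⟩
  have hl : 0 ≤ Real.log (1 + y) := Real.log_nonneg (by linarith)
  have hg := ell_pos hk hy
  have hgs : k - k^2/4 ≤ (1 - y)^2 + k * y := by nlinarith [sq_nonneg (y - (1 - k/2))]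
  have h3 : 0 ≤ 3 / (k - k^2/4) * Real.log (1 + y) := by positivity
  rw [abs_le]
  constructor
  · by_cases hy2 : y ≤ 2
    · have h1 : 1 - ((1 - y)^2 + k * y)⁻¹ ≤ Real.log ((1 - y)^2 + k * y) := Real.one_sub_inv_le_log_of_pos hg
      have h2 : y / 3 ≤ Real.log (1 + y) := by
        have := Real.one_sub_inv_le_log_of_pos (show 0 < 1 + y by linarith)
        refine le_trans ?_ this
        have : 1 - (1 + y)⁻¹ = y / (1 + y) := by field_simp; ring
        rw [this]
        gcongr
        linarith
      have h4 : ((1 - y)^2 + k * y)⁻¹ - 1 ≤ 2 * y / (k - k^2/4) := by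
        have : ((1 - y)^2 + k * y)⁻¹ - 1 = ((2 - k) * y - y^2) / ((1 - y)^2 + k * y) := by
          have hg' := hg.ne'
          rw [eq_div_iff hg', sub_mul, inv_mul_cancel₀ hg']; ring
        rw [this]
        gcongr
        nlinarith
      have h5 : y / (k - k^2/4) ≤ 3 / (k - k^2/4) * Real.log (1 + y) := by
        rw [div_mul_eq_mul_div]
        gcongr
        linarith
      have h6 : 2 * y / (k - k^2/4) = 2 * (y / (k - k^2/4)) := by ring
      unfold ell
      nlinarith
    · push Not at hy2
      have : 0 ≤ ell k y := by
        unfold ell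
        have := Real.log_nonneg (show 1 ≤ (1 - y)^2 + k * y by nlinarith)
        linarith
      nlinarith
  · have h1 : ell k y ≤ Real.log (1 + y) := by
      unfold ell
      have h2 : Real.log ((1 - y)^2 + k * y) ≤ Real.log ((1 + y)^2) :=
        Real.log_le_log hg (by nlinarith)
      rw [Real.log_pow] at h2
      push_cast at h2
      linarith
    nlinarith

theorem ell_cont {k : ℝ} (hk : 0 < k) {f : ℝ → ℝ} {s : Set ℝ} (hf : ContinuousOn f s) (h0 : ∀ x ∈ s, 0 ≤ f x) :
    ContinuousOn (fun x => ell k (f x)) s := by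
  unfold ell
  refine ContinuousOn.mul continuousOn_const (ContinuousOn.log ?_ fun x hx => (ell_pos hk (h0 x hx)).ne')
  fun_prop

theorem phi_integral {ε : ℝ} (h0 : 0 < ε) (h1 : ε < 1/2) :
    ∫ u in ε..(1-ε), Real.log (1 - u^2) * (1 + (u^2)⁻¹) ≤ -2 + 4 * ε + 4 * √(2 * ε) := by
  have hFTC : ∫ u in ε..(1-ε), Real.log (1 - u^2) * (1 + (u^2)⁻¹) =
      (fun u => (u - u⁻¹) * Real.log (1 - u^2) - 2 * u) (1-ε) -
      (fun u => (u - u⁻¹) * Real.log (1 - u^2) - 2 * u) ε := by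
    have hmem : ∀ u ∈ Set.uIcc ε (1-ε), 0 < u ∧ 0 < 1 - u^2 := by
      intro u hu
      rw [Set.uIcc_of_le (by linarith)] at hu
      exact ⟨by linarith [hu.1], by nlinarith [hu.1, hu.2]⟩
    refine intervalIntegral.integral_eq_sub_of_hasDerivAt (f := fun u => (u - u⁻¹) * Real.log (1 - u^2) - 2 * u) ?_ ?_
    · intro u hu
      obtain ⟨hu0, hu1⟩ := hmem u hu
      have d1 : HasDerivAt (fun u : ℝ => u - u⁻¹) (1 - (-(u^2)⁻¹)) u :=
        (hasDerivAt_id u).sub (hasDerivAt_inv hu0.ne')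
      have d2 : HasDerivAt (fun u : ℝ => 1 - u^2) (-(2 * u)) u := by
        simpa using (hasDerivAt_pow 2 u).const_sub 1
      have d3 := (d1.mul (d2.log hu1.ne')).sub ((hasDerivAt_id u).const_mul 2)
      have e1 : (1 - -(u ^ 2)⁻¹) * Real.log (1 - u ^ 2) + (u - u⁻¹) * (-(2 * u) / (1 - u ^ 2)) - 2 * 1 =
        Real.log (1 - u^2) * (1 + (u^2)⁻¹) := by
        have : (u - u⁻¹) * (-(2 * u) / (1 - u ^ 2)) = 2 := by
          field_simp; ring
        rw [this]; ring
      rw [e1] at d3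
      exact d3
    · apply ContinuousOn.intervalIntegrable
      refine ContinuousOn.mul (ContinuousOn.log (by fun_prop) fun u hu => (hmem u hu).2.ne') ?_
      refine ContinuousOn.add continuousOn_const (ContinuousOn.inv₀ (by fun_prop) fun u hu => ?_)
      have := (hmem u hu).1
      positivity
  rw [hFTC]
  simp only
  have hA : -(2 * ε) ≤ (ε - ε⁻¹) * Real.log (1 - ε^2) - 2 * ε := by
    have h2 : ε - ε⁻¹ ≤ 0 := by
      have : 1 ≤ ε⁻¹ := (one_le_inv₀ h0).2 (by linarith)
      linarith
    have h3 : Real.log (1 - ε^2) ≤ 0 := Real.log_nonpos (by nlinarith) (by nlinarith)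
    nlinarith [mul_nonneg_of_nonpos_of_nonpos h2 h3]
  have hB : ((1-ε) - (1-ε)⁻¹) * Real.log (1 - (1-ε)^2) ≤ 4 * √(2 * ε) := by
    set v := 1 - (1-ε)^2 with hv
    have hv0 : 0 < v := by rw [hv]; nlinarith
    have hv1 : v ≤ 2 * ε := by rw [hv]; nlinarith
    have e1 : ((1-ε) - (1-ε)⁻¹) = -(v / (1-ε)) := by
      have : 1 - ε ≠ 0 := by linarith
      rw [hv]; field_simp; ring
    have h2 : -Real.log v ≤ 2 / √v := by
      have h3 := Real.one_sub_inv_le_log_of_pos (Real.sqrt_pos.2 hv0)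
      have h4 : Real.log (√v) = Real.log v / 2 := Real.log_sqrt hv0.le
      have : 2 / √v = 2 * (√v)⁻¹ := by ring
      rw [this]; linarith
    have h5 : v * (-Real.log v) ≤ 2 * √v := by
      calc v * (-Real.log v) ≤ v * (2 / √v) := by gcongr
        _ = 2 * √v := by
          have := Real.sqrt_pos.2 hv0
          field_simp
          rw [Real.sq_sqrt hv0.le]
    have h6 : √v ≤ √(2 * ε) := Real.sqrt_le_sqrt hv1
    rw [e1]
    calc -(v / (1-ε)) * Real.log v = (v * (-Real.log v)) / (1-ε) := by ring
      _ ≤ (2 * √v) / (1-ε) := by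
        have : 0 < 1 - ε := by linarith
        gcongr
      _ ≤ (2 * √v) / (1/2) := by gcongr; linarith
      _ ≤ _ := by linarith
  linarith

theorem exists_k_neg {α : ℝ} (h1 : 1 < α) (h2 : α < 2) :
    ∃ k ε : ℝ, 0 < k ∧ k ≤ 1 ∧ 0 < ε ∧ ε < 1/2 ∧
      ∫ u in ε..(1-ε), ell k (u^α) * (1 + (u^2)⁻¹) < -α := by
  have hlim : Tendsto (fun ε : ℝ => -2 + 4 * ε + 4 * √(2 * ε)) (𝓝[>] 0) (𝓝 (-2 + 4 * 0 + 4 * √(2 * 0))) := by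
    apply Tendsto.mono_left _ nhdsWithin_le_nhds
    apply Continuous.tendsto
    fun_prop
  have hlim' : -2 + 4 * 0 + 4 * √(2 * 0) < -α := by simp; exact h2
  obtain ⟨ε, hε, hε0, hε1⟩ := ((hlim.eventually (gt_mem_nhds hlim')).and
    (Ioo_mem_nhdsGT (show (0:ℝ) < 1/2 by norm_num))).exists
  have hε0 : 0 < ε := hε0
  have hI := (phi_integral hε0 hε1).trans_lt hε
  set I := ∫ u in ε..(1-ε), Real.log (1 - u^2) * (1 + (u^2)⁻¹) with hIdef
  set y0 := (1-ε)^α with hy0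
  have hy01 : y0 < 1 := Real.rpow_lt_one (by linarith) (by linarith) (by linarith)
  set m := 1 / (2 * (1 - y0)^2) with hm
  have hm0 : 0 < m := by
    have : 0 < 1 - y0 := by linarith
    positivity
  set Cc := 1 + (ε^2)⁻¹ with hCc
  have hCc0 : 0 < Cc := by positivity
  set k := min 1 ((-α - I) / (2 * m * Cc)) with hk
  have hk0 : 0 < k := lt_min one_pos (by apply div_pos <;> [linarith; positivity])
  have hk2 : k * m * Cc < -α - I := by
    have : k ≤ (-α - I) / (2 * m * Cc) := min_le_right _ _
    rw [le_div_iff₀ (by positivity)] at this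
    nlinarith
  refine ⟨k, ε, hk0, min_le_left _ _, hε0, hε1, ?_⟩
  have hle : ε ≤ 1 - ε := by linarith
  have hcon1 : ContinuousOn (fun u : ℝ => 1 + (u^2)⁻¹) (Set.uIcc ε (1-ε)) := by
    refine ContinuousOn.add continuousOn_const (ContinuousOn.inv₀ (by fun_prop) fun u hu => ?_)
    rw [Set.uIcc_of_le hle] at hu
    have : 0 < u := by linarith [hu.1]
    positivity
  have hcon2 : ContinuousOn (fun u : ℝ => Real.log (1 - u^2)) (Set.uIcc ε (1-ε)) := by
    refine ContinuousOn.log (by fun_prop) fun u hu => ?_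
    rw [Set.uIcc_of_le hle] at hu
    nlinarith [hu.1, hu.2]
  have hmono : ∫ u in ε..(1-ε), ell k (u^α) * (1 + (u^2)⁻¹) ≤
      ∫ u in ε..(1-ε), (Real.log (1 - u^2) * (1 + (u^2)⁻¹) + k * m * Cc) := by
    apply intervalIntegral.integral_mono_on hle
    · apply ContinuousOn.intervalIntegrable
      refine ContinuousOn.mul (ell_cont hk0 ?_ ?_) hcon1
      · refine ContinuousOn.rpow_const continuousOn_id fun u hu => Or.inr (by linarith)
      · intro u hu
        rw [Set.uIcc_of_le hle] at hu
        exact Real.rpow_nonneg (by linarith [hu.1]) _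
    · apply ContinuousOn.intervalIntegrable
      exact (hcon2.mul hcon1).add continuousOn_const
    · intro u hu
      have hu0 : 0 < u := by linarith [hu.1]
      have hu1 : u < 1 := by linarith [hu.2]
      set y := u^α with hy
      have hyp : 0 < y := Real.rpow_pos_of_pos hu0 _
      have hyy0 : y ≤ y0 := Real.rpow_le_rpow hu0.le hu.2 (by linarith)
      have hyu : u^2 ≤ y := by
        rw [hy, ← Real.rpow_natCast u 2]
        exact Real.rpow_le_rpow_of_exponent_ge hu0 hu1.le (by push_cast; linarith)
      have h3 : ell k y ≤ Real.log (1 - u^2) + k * m := by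
        have hd : 0 < 1 - y := by linarith
        have e1 : (1 - y)^2 + k * y = (1 - y)^2 * (1 + k * y / (1-y)^2) := by
          field_simp
        unfold ell
        rw [e1, Real.log_mul (by positivity) (by positivity), Real.log_pow]
        have h4 : Real.log (1 - y) ≤ Real.log (1 - u^2) := Real.log_le_log hd (by linarith)
        have h5 : Real.log (1 + k * y / (1-y)^2) ≤ k * y / (1-y)^2 := by
          have := Real.log_le_sub_one_of_pos (show 0 < 1 + k * y / (1-y)^2 by positivity)
          linarith
        have h6 : k * y / (1-y)^2 ≤ k * 1 / (1-y0)^2 := by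
          have : 0 < 1 - y0 := by linarith
          gcongr
          linarith
        have h7 : k * 1 / (1-y0)^2 = 2 * (k * m) := by
          have : 0 < 1 - y0 := by linarith
          rw [hm]; field_simp
        push_cast
        linarith
      have h8 : 0 < 1 + (u^2)⁻¹ := by positivity
      have h9 : 1 + (u^2)⁻¹ ≤ Cc := by
        rw [hCc]; have := hu.1; gcongr
      calc ell k y * (1 + (u^2)⁻¹) ≤ (Real.log (1 - u^2) + k * m) * (1 + (u^2)⁻¹) := by gcongr
        _ = Real.log (1 - u^2) * (1 + (u^2)⁻¹) + k * m * (1 + (u^2)⁻¹) := by ring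
        _ ≤ _ := by gcongr
  refine hmono.trans_lt ?_
  rw [intervalIntegral.integral_add, intervalIntegral.integral_const, smul_eq_mul, ← hIdef]
  · have : 0 < k * m * Cc := by positivity
    nlinarith
  · exact ContinuousOn.intervalIntegrable (hcon2.mul hcon1)
  · exact intervalIntegrable_const

end PartP7

section PartP7b

open MeasureTheory

theorem log_dom_integrable {α B : ℝ} (h1 : 1 < α) (h2 : α < 2) (hB : 0 ≤ B) :
    IntegrableOn (fun u : ℝ => Real.log (1 + B * u ^ (-α))) (Set.Ioi 0) := by
  have hmeas : Measurable (fun u : ℝ => Real.log (1 + B * u ^ (-α))) := by fun_prop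
  rw [← Set.Ioc_union_Ioi_eq_Ioi (zero_le_one' ℝ)]
  refine IntegrableOn.union ?_ ?_
  · have hi : IntegrableOn (fun u : ℝ => (4 * B ^ (1/4:ℝ)) * u ^ (-(α/4))) (Set.Ioc 0 1) := by
      refine Integrable.const_mul ?_ _
      have := intervalIntegral.intervalIntegrable_rpow' (a := 0) (b := 1) (show -1 < -(α/4) by linarith)
      rwa [intervalIntegrable_iff_integrableOn_Ioc_of_le zero_le_one] at this
    refine Integrable.mono' hi hmeas.aestronglyMeasurable ?_
    refine (ae_restrict_iff' measurableSet_Ioc).2 (Eventually.of_forall fun u hu => ?_)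
    have hu0 : 0 < u := hu.1
    have hp : 0 ≤ u ^ (-α) := Real.rpow_nonneg hu0.le _
    rw [Real.norm_of_nonneg (Real.log_nonneg (by nlinarith [mul_nonneg hB hp]))]
    refine (log_one_add_le_rpow (δ := 1/4) (mul_nonneg hB hp) (by norm_num) (by norm_num)).trans (le_of_eq ?_)
    rw [Real.mul_rpow hB hp, ← Real.rpow_mul hu0.le]
    have : -α * (1/4) = -(α/4) := by ring
    rw [this]; ring
  · have hi : IntegrableOn (fun u : ℝ => B * u ^ (-α)) (Set.Ioi 1) :=
      Integrable.const_mul (integrableOn_Ioi_rpow_of_lt (by linarith) one_pos) _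
    refine Integrable.mono' hi hmeas.aestronglyMeasurable ?_
    refine (ae_restrict_iff' measurableSet_Ioi).2 (Eventually.of_forall fun u hu => ?_)
    have hu0 : 0 < u := lt_trans one_pos hu
    have hp : 0 ≤ B * u ^ (-α) := mul_nonneg hB (Real.rpow_nonneg hu0.le _)
    rw [Real.norm_of_nonneg (Real.log_nonneg (by linarith))]
    have := Real.log_le_sub_one_of_pos (show 0 < 1 + B * u ^ (-α) by linarith)
    linarith

theorem ell_integrable {α k : ℝ} (h1 : 1 < α) (h2 : α < 2) (hk : 0 < k) (hk1 : k ≤ 1) :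
    IntegrableOn (fun u : ℝ => ell k (u ^ (-α))) (Set.Ioi 0) := by
  obtain ⟨K, hK, hK2⟩ := ell_abs hk hk1
  have hi : IntegrableOn (fun u : ℝ => K * Real.log (1 + 1 * u ^ (-α))) (Set.Ioi 0) :=
    Integrable.const_mul (log_dom_integrable h1 h2 zero_le_one) _
  refine Integrable.mono' hi ?_ ?_
  · refine Measurable.aestronglyMeasurable ?_
    unfold ell
    fun_prop
  · refine (ae_restrict_iff' measurableSet_Ioi).2 (Eventually.of_forall fun u hu => ?_)
    rw [one_mul]
    exact hK2 _ (Real.rpow_nonneg (le_of_lt hu) _)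

theorem mono_neg_set {f : ℝ → ℝ} {s t : Set ℝ} (ht : MeasurableSet t) (hi : IntegrableOn f t) (hst : s ⊆ t)
    (hf : ∀ x ∈ t, f x ≤ 0) : ∫ x in t, f x ≤ ∫ x in s, f x := by
  have := setIntegral_mono_set (f := fun x => - f x) (s := s) (t := t) hi.neg
    ((ae_restrict_iff' ht).2 (Eventually.of_forall fun u hu => by
      have := hf u hu
      simp only [Pi.zero_apply]
      linarith)) (Eventually.of_forall hst)
  rw [integral_neg, integral_neg] at this
  linarith

theorem ell_integral_neg {α : ℝ} (h1 : 1 < α) (h2 : α < 2) :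
    ∃ k, 0 < k ∧ k ≤ 1 ∧ ∫ u in Set.Ioi (0:ℝ), ell k (u ^ (-α)) < 0 := by
  obtain ⟨k, ε, hk, hk1, hε, hε1, hneg⟩ := exists_k_neg h1 h2
  refine ⟨k, hk, hk1, ?_⟩
  have hI := ell_integrable h1 h2 hk hk1
  have hle : ε ≤ 1 - ε := by linarith
  have hpos : 0 < 1 - ε := by linarith
  rw [← Set.Ioc_union_Ioi_eq_Ioi (zero_le_one' ℝ)] at hI ⊢
  have hI1 := hI.mono_set (Set.subset_union_left)
  have hI2 := hI.mono_set (Set.subset_union_right)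
  rw [setIntegral_union (Set.Ioc_disjoint_Ioi le_rfl) measurableSet_Ioi hI1 hI2]
  have hinv : ∀ u : ℝ, 0 < u → ell k (u ^ (-α)) = ell k (u ^ α) - α * Real.log u := by
    intro u hu
    rw [Real.rpow_neg hu.le, ell_inv hk (Real.rpow_pos_of_pos hu _), Real.log_rpow hu]
  have hlog : IntegrableOn (fun u : ℝ => α * Real.log u) (Set.Ioc 0 1) := by
    have := (intervalIntegral.intervalIntegrable_log' (a := 0) (b := 1)).const_mul α
    rwa [intervalIntegrable_iff_integrableOn_Ioc_of_le zero_le_one] at this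
  have hlogv : ∫ u in Set.Ioc (0:ℝ) 1, α * Real.log u = -α := by
    rw [← intervalIntegral.integral_of_le zero_le_one, intervalIntegral.integral_const_mul, integral_log]
    simp
  have hI1' : IntegrableOn (fun u : ℝ => ell k (u ^ α)) (Set.Ioc 0 1) := by
    refine (hI1.add hlog).congr_fun (fun u hu => ?_) measurableSet_Ioc
    simp only [Pi.add_apply]
    rw [hinv u hu.1]; ring
  have hP1 : ∫ u in Set.Ioc (0:ℝ) 1, ell k (u ^ (-α)) ≤ (∫ u in ε..(1-ε), ell k (u^α)) + α := by
    rw [setIntegral_congr_fun measurableSet_Ioc (fun u hu => hinv u hu.1), integral_sub hI1' hlog, hlogv,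
      intervalIntegral.integral_of_le hle]
    have := mono_neg_set (s := Set.Ioc ε (1-ε)) measurableSet_Ioc hI1'
      (Set.Ioc_subset_Ioc hε.le (by linarith)) (fun x hx => ell_nonpos hk hk1 (Real.rpow_nonneg hx.1.le _)
        (Real.rpow_le_one hx.1.le hx.2 (by linarith)))
    linarith
  have hii : (1-ε)⁻¹ ≤ ε⁻¹ := inv_anti₀ hε hle
  have hP2 : ∫ u in Set.Ioi (1:ℝ), ell k (u ^ (-α)) ≤ ∫ u in ε..(1-ε), ell k (u^α) * (u^2)⁻¹ := by
    have h3 := mono_neg_set (s := Set.Ioc (1-ε)⁻¹ ε⁻¹) measurableSet_Ioi hI2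
      (fun x hx => lt_of_le_of_lt ((one_le_inv₀ hpos).2 (by linarith)) hx.1) (fun x hx => by
        have hx0 : (0:ℝ) < x := lt_trans one_pos hx
        exact ell_nonpos hk hk1 (Real.rpow_nonneg hx0.le _) (Real.rpow_le_one_of_one_le_of_nonpos (le_of_lt hx) (by linarith)))
    refine h3.trans (le_of_eq ?_)
    rw [← intervalIntegral.integral_of_le hii, intervalIntegral.integral_symm]
    have hsub := intervalIntegral.integral_comp_mul_deriv' (a := ε) (b := 1-ε) (f := fun x : ℝ => x⁻¹)
      (f' := fun x => -(x^2)⁻¹) (g := fun u => ell k (u ^ (-α))) ?_ ?_ ?_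
    · rw [← hsub, ← intervalIntegral.integral_neg]
      apply intervalIntegral.integral_congr
      intro x hx
      rw [Set.uIcc_of_le hle] at hx
      have hx0 : 0 < x := by linarith [hx.1]
      simp only [Function.comp]
      rw [Real.inv_rpow hx0.le, Real.rpow_neg hx0.le, inv_inv]; ring
    · intro x hx
      rw [Set.uIcc_of_le hle] at hx
      exact hasDerivAt_inv (by linarith [hx.1])
    · refine ContinuousOn.neg (ContinuousOn.inv₀ (by fun_prop) fun u hu => ?_)
      rw [Set.uIcc_of_le hle] at hu
      have : 0 < u := by linarith [hu.1]
      positivity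
    · have hp : ∀ x ∈ (fun x : ℝ => x⁻¹) '' (Set.uIcc ε (1-ε)), 0 < x := by
        rintro _ ⟨u, hu, rfl⟩
        rw [Set.uIcc_of_le hle] at hu
        have : 0 < u := by linarith [hu.1]
        positivity
      refine ell_cont hk ?_ fun x hx => Real.rpow_nonneg (hp x hx).le _
      exact ContinuousOn.rpow_const continuousOn_id fun x hx => Or.inl (hp x hx).ne'
  have hsum : (∫ u in ε..(1-ε), ell k (u^α)) + (∫ u in ε..(1-ε), ell k (u^α) * (u^2)⁻¹) =
      ∫ u in ε..(1-ε), ell k (u^α) * (1 + (u^2)⁻¹) := by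
    have hc1 : ContinuousOn (fun u : ℝ => ell k (u^α)) (Set.uIcc ε (1-ε)) := by
      refine (ell_cont hk ?_ ?_)
      · refine ContinuousOn.rpow_const continuousOn_id fun u hu => Or.inr (by linarith)
      · intro u hu
        rw [Set.uIcc_of_le hle] at hu
        exact Real.rpow_nonneg (by linarith [hu.1]) _
    rw [← intervalIntegral.integral_add hc1.intervalIntegrable]
    · congr 1; ext u; ring
    · refine (hc1.mul (ContinuousOn.inv₀ (by fun_prop) fun u hu => ?_)).intervalIntegrable
      rw [Set.uIcc_of_le hle] at hu
      have : 0 < u := by linarith [hu.1]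
      positivity
  linarith

end PartP7b

section PartP8

open MeasureTheory

theorem exists_bound_of_tendsto {α l : ℝ} (c : ℕ → ℝ)
    (hcl : Tendsto (fun j : ℕ => ((j:ℝ)+1) ^ α * c j) atTop (𝓝 l)) :
    ∃ B : ℝ, 0 < B ∧ ∀ j, c j ≤ B * ((j:ℝ)+1) ^ (-α) := by
  obtain ⟨B, hB⟩ := hcl.bddAbove_range
  refine ⟨max B 1, by positivity, fun j => ?_⟩
  have h1 : ((j:ℝ)+1) ^ α * c j ≤ B := hB ⟨j, rfl⟩
  have hj : (0:ℝ) < (j:ℝ)+1 := by positivity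
  have hp := Real.rpow_pos_of_pos hj α
  rw [Real.rpow_neg hj.le, ← div_eq_mul_inv, le_div_iff₀ hp]
  have := le_max_left B 1
  linarith

theorem summable_shift_rpow {α : ℝ} (h1 : 1 < α) : Summable (fun j : ℕ => ((j:ℝ)+1) ^ (-α)) := by
  have := (summable_nat_add_iff (f := fun n : ℕ => (n:ℝ) ^ (-α)) 1).2 (Real.summable_nat_rpow.2 (by linarith))
  simpa using this

theorem core_real {α a k K' : ℝ} (h1 : 1 < α) (h2 : α < 2) (ha : 0 < a) (hk : 0 < k) (hk1 : k ≤ 1)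
    (hK' : 0 < K') (hneg : ∫ u in Set.Ioi (0:ℝ), ell k (u ^ (-α)) < 0)
    (c τ : ℕ → ℝ) (hc : ∀ j, 0 ≤ c j) (hτ : ∀ j, 0 ≤ τ j)
    (hcl : Tendsto (fun j : ℕ => ((j:ℝ)+1) ^ α * c j) atTop (𝓝 a))
    (hτl : Tendsto (fun j : ℕ => ((j:ℝ)+1) ^ α * τ j) atTop (𝓝 0))
    (hH : ∀ x : ℝ, 0 < x → 0 ≤ ∑' j, ell k (x * c j) + ∑' j, Real.log (1 + K' * x * τ j)) : False := by
  obtain ⟨K, hK, hKe⟩ := ell_abs hk hk1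
  obtain ⟨B, hB, hBc⟩ := exists_bound_of_tendsto c hcl
  obtain ⟨B', hB', hBt⟩ := exists_bound_of_tendsto τ hτl
  set N : ℕ → ℝ := fun n => (n:ℝ) + 1 with hN
  have hNpos : ∀ n, 0 < N n := fun n => by positivity
  set X : ℕ → ℝ := fun n => N n ^ α / a with hX
  have hXpos : ∀ n, 0 < X n := fun n => div_pos (Real.rpow_pos_of_pos (hNpos n) _) ha
  set f : ℕ → ℕ → ℝ := fun n j => ell k (X n * c j) + Real.log (1 + K' * X n * τ j) with hf
  set G : ℕ → ℝ → ℝ := fun n u => f n ⌊N n * u⌋₊ with hG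
  set D : ℝ → ℝ := fun u => K * Real.log (1 + B / a * u ^ (-α)) + Real.log (1 + K' * B' / a * u ^ (-α)) with hD
  have hDint : IntegrableOn D (Set.Ioi 0) :=
    (Integrable.const_mul (log_dom_integrable h1 h2 (by positivity)) _).add
      (log_dom_integrable h1 h2 (by positivity))
  have hGmeas : ∀ n, Measurable (G n) := fun n =>
    (measurable_from_top (f := f n)).comp (Nat.measurable_floor.comp (measurable_const.mul measurable_id))
  have hscale : ∀ n (u : ℝ), 0 < u → ∀ (b : ℝ) (d : ℕ → ℝ), 0 < b → (∀ j, d j ≤ b * ((j:ℝ)+1) ^ (-α)) →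
      X n * d ⌊N n * u⌋₊ ≤ b / a * u ^ (-α) := by
    intro n u hu b d hb hd
    have hNu : 0 < N n * u := mul_pos (hNpos n) hu
    have h3 : ((⌊N n * u⌋₊ : ℝ) + 1) ^ (-α) ≤ (N n * u) ^ (-α) :=
      Real.rpow_le_rpow_of_nonpos hNu (Nat.lt_floor_add_one _).le (by linarith)
    have h4 : d ⌊N n * u⌋₊ ≤ b * (N n * u) ^ (-α) := (hd _).trans (by gcongr)
    calc X n * d ⌊N n * u⌋₊ ≤ X n * (b * (N n * u) ^ (-α)) := by
          have := (hXpos n).le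
          gcongr
      _ = b / a * u ^ (-α) := by
          rw [Real.mul_rpow (hNpos n).le hu.le, Real.rpow_neg (hNpos n).le, hX]
          have := Real.rpow_pos_of_pos (hNpos n) α
          field_simp
  have hbound : ∀ n (u : ℝ), 0 < u → ‖G n u‖ ≤ D u := by
    intro n u hu
    have h3 := hscale n u hu B c hB hBc
    have h4 := hscale n u hu B' τ hB' hBt
    have h5 : 0 ≤ X n * c ⌊N n * u⌋₊ := mul_nonneg (hXpos n).le (hc _)
    have h6 : 0 ≤ X n * τ ⌊N n * u⌋₊ := mul_nonneg (hXpos n).le (hτ _)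
    refine (norm_add_le _ _).trans (add_le_add ?_ ?_)
    · refine (hKe _ h5).trans ?_
      gcongr
    · have h7 : 0 ≤ K' * X n * τ ⌊N n * u⌋₊ := by rw [mul_assoc]; positivity
      rw [Real.norm_of_nonneg (Real.log_nonneg (by linarith))]
      apply Real.log_le_log (by linarith)
      have h8 := mul_le_mul_of_nonneg_left h4 hK'.le
      have e : K' * B' / a * u ^ (-α) = K' * (B' / a * u ^ (-α)) := by ring
      rw [e, mul_assoc K']
      linarith
  have hGint : ∀ n, IntegrableOn (G n) (Set.Ioi 0) := fun n =>
    Integrable.mono' hDint (hGmeas n).aestronglyMeasurable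
      ((ae_restrict_iff' measurableSet_Ioi).2 (Eventually.of_forall fun u hu => hbound n u hu))
  have hNt : Tendsto N atTop atTop := tendsto_atTop_add_const_right _ _ tendsto_natCast_atTop_atTop
  have hlim : ∀ u : ℝ, 0 < u → Tendsto (fun n => G n u) atTop (𝓝 (ell k (u ^ (-α)))) := by
    intro u hu
    have t1 : Tendsto (fun n => ((⌊N n * u⌋₊ : ℝ) + 1) / N n) atTop (𝓝 u) := by
      have h3 := (tendsto_nat_floor_mul_div_atTop hu.le).comp hNt
      have h4 := h3.add (tendsto_inv_atTop_zero.comp hNt)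
      rw [add_zero] at h4
      refine h4.congr fun n => ?_
      simp only [Function.comp]
      rw [mul_comm u]; field_simp
    have t2 : Tendsto (fun n => ⌊N n * u⌋₊) atTop atTop :=
      tendsto_nat_floor_atTop.comp (hNt.atTop_mul_const hu)
    have t3 : Tendsto (fun n => (((⌊N n * u⌋₊ : ℝ) + 1) / N n) ^ (-α)) atTop (𝓝 (u ^ (-α))) :=
      t1.rpow_const (Or.inl hu.ne')
    have key : ∀ (l : ℝ) (d : ℕ → ℝ), Tendsto (fun j : ℕ => ((j:ℝ)+1) ^ α * d j) atTop (𝓝 l) →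
        Tendsto (fun n => X n * d ⌊N n * u⌋₊) atTop (𝓝 (l / a * u ^ (-α))) := by
      intro l d hd
      refine (((hd.comp t2).div_const a).mul t3).congr fun n => ?_
      simp only [Function.comp]
      have hj : (0:ℝ) < (⌊N n * u⌋₊ : ℝ) + 1 := by positivity
      rw [Real.rpow_neg (div_pos hj (hNpos n)).le, Real.div_rpow hj.le (hNpos n).le, hX]
      have := Real.rpow_pos_of_pos (hNpos n) α
      have := Real.rpow_pos_of_pos hj α
      field_simp
    have k1 := key a c hcl
    rw [div_self ha.ne', one_mul] at k1
    have k2 := key 0 τ hτl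
    rw [zero_div, zero_mul] at k2
    have hup : 0 ≤ u ^ (-α) := Real.rpow_nonneg hu.le _
    have e1 : Tendsto (fun n => ell k (X n * c ⌊N n * u⌋₊)) atTop (𝓝 (ell k (u ^ (-α)))) := by
      unfold ell
      refine Tendsto.const_mul _ (Tendsto.log ?_ (ell_pos hk hup).ne')
      exact ((k1.const_sub 1).pow 2).add (k1.const_mul k)
    have e2 : Tendsto (fun n => Real.log (1 + K' * X n * τ ⌊N n * u⌋₊)) atTop (𝓝 0) := by
      have h3 : Tendsto (fun n => 1 + K' * (X n * τ ⌊N n * u⌋₊)) atTop (𝓝 (1 + K' * 0)) :=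
        (k2.const_mul K').const_add 1
      have h4 := h3.log (by simp)
      simp only [mul_zero, add_zero, Real.log_one] at h4
      refine h4.congr fun n => ?_
      rw [mul_assoc]
    have := e1.add e2
    rwa [add_zero] at this
  have hDCT : Tendsto (fun n => ∫ u in Set.Ioi (0:ℝ), G n u) atTop (𝓝 (∫ u in Set.Ioi (0:ℝ), ell k (u ^ (-α)))) := by
    refine tendsto_integral_of_dominated_convergence D (fun n => (hGmeas n).aestronglyMeasurable) hDint
      (fun n => (ae_restrict_iff' measurableSet_Ioi).2 (Eventually.of_forall fun u hu => hbound n u hu))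
      ((ae_restrict_iff' measurableSet_Ioi).2 (Eventually.of_forall fun u hu => hlim u hu))
  have hsumc : Summable c := Summable.of_nonneg_of_le hc hBc ((summable_shift_rpow h1).mul_left _)
  have hsumt : Summable τ := Summable.of_nonneg_of_le hτ hBt ((summable_shift_rpow h1).mul_left _)
  have hnn : ∀ n, 0 ≤ ∫ u in Set.Ioi (0:ℝ), G n u := by
    intro n
    have hs1 : Summable (fun j => ell k (X n * c j)) := by
      refine Summable.of_norm_bounded (g := fun j => K * X n * c j) (hsumc.mul_left _) fun j => ?_
      have h5 : 0 ≤ X n * c j := mul_nonneg (hXpos n).le (hc _)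
      refine (hKe _ h5).trans ?_
      have := Real.log_le_sub_one_of_pos (show 0 < 1 + X n * c j by linarith)
      rw [mul_assoc]
      gcongr
      linarith
    have hs2 : Summable (fun j => Real.log (1 + K' * X n * τ j)) := by
      refine Summable.of_norm_bounded (g := fun j => K' * X n * τ j) (hsumt.mul_left _) fun j => ?_
      have h5 : 0 ≤ K' * X n * τ j := mul_nonneg (mul_nonneg hK'.le (hXpos n).le) (hτ _)
      rw [Real.norm_of_nonneg (Real.log_nonneg (by linarith))]
      have := Real.log_le_sub_one_of_pos (show 0 < 1 + K' * X n * τ j by linarith)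
      linarith
    have hfs : 0 ≤ ∑' j, f n j := by
      rw [hf]
      simp only
      rw [hs1.tsum_add hs2]
      exact hH _ (hXpos n)
    set S : ℕ → Set ℝ := fun j => Set.Ico ((j:ℝ) / N n) (((j:ℝ)+1) / N n) with hS
    have hfl : ∀ j, ∀ u ∈ S j, ⌊N n * u⌋₊ = j := by
      intro j u hu
      have hu1 := hu.1
      have hu2 := hu.2
      rw [div_le_iff₀ (hNpos n)] at hu1
      rw [lt_div_iff₀ (hNpos n)] at hu2
      rw [Nat.floor_eq_iff (by rw [mul_comm]; exact le_trans (Nat.cast_nonneg j) hu1)]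
      constructor <;> linarith
    have hU : ⋃ j, S j = Set.Ici 0 := by
      ext u
      simp only [Set.mem_iUnion, Set.mem_Ici]
      constructor
      · rintro ⟨j, hj⟩
        exact le_trans (by have := hNpos n; positivity) hj.1
      · intro hu
        refine ⟨⌊N n * u⌋₊, ?_, ?_⟩
        · rw [div_le_iff₀ (hNpos n), mul_comm u]
          exact Nat.floor_le (mul_nonneg (hNpos n).le hu)
        · rw [lt_div_iff₀ (hNpos n), mul_comm u]
          exact Nat.lt_floor_add_one _
    have hdis : Pairwise (Function.onFun Disjoint S) := by
      intro i j hij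
      rw [Function.onFun, Set.disjoint_left]
      intro u hi hj
      exact hij ((hfl i u hi).symm.trans (hfl j u hj))
    have hhs := hasSum_integral_iUnion (μ := volume) (f := G n) (s := S) (fun j => measurableSet_Ico) hdis
      (by rw [hU, integrableOn_Ici_iff_integrableOn_Ioi]; exact hGint n)
    rw [hU, integral_Ici_eq_integral_Ioi] at hhs
    have hval : ∀ j, ∫ u in S j, G n u = (N n)⁻¹ * f n j := by
      intro j
      rw [setIntegral_congr_fun (g := fun _ => f n j) measurableSet_Ico (fun u hu => by
        simp only [hG]; rw [hfl j u hu])]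
      rw [setIntegral_const, smul_eq_mul]
      congr 1
      have hlt : (j:ℝ) / N n ≤ ((j:ℝ)+1) / N n := by
        have := hNpos n
        gcongr; linarith
      simp only [hS, Measure.real, Real.volume_Ico]
      rw [ENNReal.toReal_ofReal (by linarith)]
      ring
    rw [← hhs.tsum_eq]
    simp only [hval]
    rw [tsum_mul_left]
    exact mul_nonneg (inv_nonneg.2 (hNpos n).le) hfs
  exact absurd (ge_of_tendsto' hDCT hnn) (not_le.2 hneg)

end PartP8

section PartP9

open MeasureTheory

variable {H : Type*} [NormedAddCommGroup H] [InnerProductSpace ℂ H]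

theorem tendsto_shift_rpow {β : ℝ} (hβ : 0 < β) :
    Tendsto (fun j : ℕ => ((j:ℝ)+1) ^ (-β)) atTop (𝓝 0) :=
  (tendsto_rpow_neg_atTop hβ).comp (tendsto_atTop_add_const_right _ _ tendsto_natCast_atTop_atTop)

theorem tendsto_zero_of_bound {β B : ℝ} (hβ : 0 < β) (c : ℕ → ℝ) (hc : ∀ j, 0 ≤ c j)
    (hB : ∀ j : ℕ, c j ≤ B * ((j:ℝ)+1) ^ (-β)) : Tendsto c atTop (𝓝 0) := by
  refine squeeze_zero hc hB ?_
  have := (tendsto_shift_rpow hβ).const_mul B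
  rwa [mul_zero] at this

theorem half_rpow_le {β : ℝ} (hβ : 0 < β) (i : ℕ) :
    (((i/2 : ℕ) : ℝ)+1) ^ (-β) ≤ 2 ^ β * ((i:ℝ)+1) ^ (-β) := by
  have h1 : ((i:ℝ)+1)/2 ≤ (((i/2 : ℕ) : ℝ)+1) := by
    have : i + 1 ≤ 2 * (i/2) + 2 := by omega
    have : (i:ℝ) + 1 ≤ 2 * ((i/2:ℕ):ℝ) + 2 := by exact_mod_cast this
    linarith
  refine (Real.rpow_le_rpow_of_nonpos (by positivity) h1 (by linarith)).trans (le_of_eq ?_)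
  rw [Real.div_rpow (by positivity) (by norm_num), Real.rpow_neg (by norm_num : (0:ℝ) ≤ 2)]
  field_simp

theorem sigma_summable {β δ B B' : ℝ} (hβ : 0 < β) (hδ : 0 < δ) (hβδ : 1 < β * δ) (c τ : ℕ → ℝ)
    (hc : ∀ j, 0 ≤ c j) (hτ : ∀ j, 0 ≤ τ j) (hB0 : 0 < B) (hB0' : 0 < B')
    (hB : ∀ j : ℕ, c j ≤ B * ((j:ℝ)+1) ^ (-β)) (hB' : ∀ j : ℕ, τ j ≤ B' * ((j:ℝ)+1) ^ (-β)) :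
    Summable (fun i => (2 * c (i/2) + 2 * τ (i/2)) ^ δ) := by
  have hn : ∀ i, 0 ≤ 2 * c (i/2) + 2 * τ (i/2) := fun i => by
    have := hc (i/2); have := hτ (i/2); linarith
  refine Summable.of_nonneg_of_le (fun i => Real.rpow_nonneg (hn i) _) (fun i => ?_)
    ((summable_shift_rpow hβδ).mul_left ((2 * (B + B') * 2 ^ β) ^ δ))
  have h1 : 2 * c (i/2) + 2 * τ (i/2) ≤ (2 * (B + B') * 2 ^ β) * ((i:ℝ)+1) ^ (-β) := by
    have h2 := half_rpow_le hβ i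
    have h3 := hB (i/2)
    have h4 := hB' (i/2)
    have h5 := mul_le_mul_of_nonneg_left h2 (show 0 ≤ 2 * (B + B') by positivity)
    nlinarith
  refine (Real.rpow_le_rpow (hn i) h1 hδ.le).trans (le_of_eq ?_)
  rw [Real.mul_rpow (by positivity) (by positivity), ← Real.rpow_mul (by positivity)]
  congr 2; ring

/-- strict majorant of the singular numbers -/
noncomputable def majT (T : H →L[ℂ] H) (j : ℕ) : ℝ := sNum T (j+1) + ((j:ℝ)+1) ^ (-2:ℝ)

theorem majT_nonneg (T : H →L[ℂ] H) (j : ℕ) : 0 ≤ majT T j :=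
  add_nonneg (sNum_nonneg _ _) (by positivity)

theorem majT_anti (T : H →L[ℂ] H) : Antitone (majT T) := by
  refine (sNum_anti T).add ?_
  intro i j hij
  have : (i:ℝ) ≤ j := by exact_mod_cast hij
  exact Real.rpow_le_rpow_of_nonpos (by positivity) (by linarith) (by norm_num)

theorem majT_approx (T : H →L[ℂ] H) : opApprox T (majT T) := by
  intro j
  obtain ⟨F, h1, h2⟩ := exists_of_sNum_lt T j (majT T j) (by
    unfold majT
    have : (0:ℝ) < ((j:ℝ)+1) ^ (-2:ℝ) := by positivity
    linarith)
  exact ⟨F, h1, h2.le⟩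

theorem majT_tendsto (T : H →L[ℂ] H) {α : ℝ} (h2 : α < 2)
    (hT : Tendsto (fun j : ℕ => ((j:ℝ)+1) ^ α * sNum T (j+1)) atTop (𝓝 0)) :
    Tendsto (fun j : ℕ => ((j:ℝ)+1) ^ α * majT T j) atTop (𝓝 0) := by
  have := hT.add (tendsto_shift_rpow (show 0 < 2 - α by linarith))
  rw [add_zero] at this
  refine this.congr fun j => ?_
  unfold majT
  rw [mul_add, ← Real.rpow_add (by positivity)]
  congr 2; ring

theorem norm_w {k : ℝ} (hk : 0 < k) (hk1 : k ≤ 1) (x y : ℝ) :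
    ‖1 - ((x:ℂ) * ⟨1 - k/2, √(k - k^2/4)⟩) * (y:ℂ)‖ ^ 2 = (1 - x*y)^2 + k * (x*y) := by
  have hs : 0 ≤ k - k^2/4 := by nlinarith
  rw [← Complex.normSq_eq_norm_sq, Complex.normSq_apply]
  simp
  have := Real.sq_sqrt hs
  linear_combination (x * y)^2 * this

theorem core_op [CompleteSpace H] (e : ℕ → H) (he : Orthonormal ℂ e) {α a : ℝ} (h1 : 1 < α) (h2 : α < 2) (ha : 0 < a)
    (c : ℕ → ℝ) (hc : Antitone c)
    (hcl : Tendsto (fun j : ℕ => ((j:ℝ)+1) ^ α * c j) atTop (𝓝 a))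
    (C T A : H →L[ℂ] H) (hA : A = C + T) (hC : ∀ j, ‖C - partC e c j‖ ≤ c j)
    (hT : Tendsto (fun j : ℕ => ((j:ℝ)+1) ^ α * sNum T (j+1)) atTop (𝓝 0))
    (hunit : ∀ z : ℂ, IsUnit (1 - z • A)) : False := by
  obtain ⟨k, hk, hk1, hneg⟩ := ell_integral_neg h1 h2
  have hcn : ∀ j, 0 ≤ c j := fun j => (norm_nonneg _).trans (hC j)
  have hτn := majT_nonneg T
  have hτl := majT_tendsto T h2 hT
  obtain ⟨B, hB, hBc⟩ := exists_bound_of_tendsto c hcl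
  obtain ⟨B', hB', hBt⟩ := exists_bound_of_tendsto _ hτl
  have hsumt : Summable (majT T) := Summable.of_nonneg_of_le hτn hBt ((summable_shift_rpow h1).mul_left _)
  have hsumc : Summable c := Summable.of_nonneg_of_le hcn hBc ((summable_shift_rpow h1).mul_left _)
  have hs2 : 0 < k - k^2/4 := by nlinarith
  set s := √(k - k^2/4) with hs
  have hs0 : 0 < s := Real.sqrt_pos.2 hs2
  have hell : ∀ x y : ℝ, 0 ≤ x * y → Real.log ‖1 - ((x:ℂ) * ⟨1 - k/2, s⟩) * (y:ℂ)‖ = ell k (x * y) := by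
    intro x y hxy
    unfold ell
    rw [← norm_w hk hk1, Real.log_pow]
    push_cast
    ring
  have hw : ‖(⟨1 - k/2, s⟩ : ℂ)‖ = 1 := by
    have : ‖(⟨1 - k/2, s⟩ : ℂ)‖ ^ 2 = 1 := by
      rw [← Complex.normSq_eq_norm_sq, Complex.normSq_apply]
      have := Real.sq_sqrt hs2.le
      simp only
      nlinarith
    exact (pow_eq_one_iff_of_nonneg (norm_nonneg _) two_ne_zero).1 this
  obtain ⟨K, hK, hKe⟩ := ell_abs hk hk1
  refine core_real (K' := 2 / s) h1 h2 ha hk hk1 (by positivity) hneg c (majT T) hcn hτn hcl hτl ?_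
  intro x hx
  have := limit_core e he c (majT T) hc (majT_anti T) (tendsto_zero_of_bound (by linarith) c hcn hBc)
    (tendsto_zero_of_bound (by linarith) _ hτn hBt) hτn C T A hA hC (majT_approx T) hunit
    ((1 + α⁻¹)/2) (by positivity) (by
      have : α⁻¹ < 1 := inv_lt_one_of_one_lt₀ h1
      linarith) (sigma_summable (β := α) (by linarith) (by positivity) (by
        have : α * α⁻¹ = 1 := mul_inv_cancel₀ (by linarith)
        nlinarith) c (majT T) hcn hτn hB hB' hBc hBt) hsumt
    ((x:ℂ) * ⟨1 - k/2, s⟩) s hs0 (by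
      intro y hy
      have h3 := norm_w hk hk1 x y
      rw [← hs] at h3
      refine (pow_le_pow_iff_left₀ hs0.le (norm_nonneg _) two_ne_zero).1 ?_
      rw [h3, hs, Real.sq_sqrt hs2.le]
      nlinarith [sq_nonneg (x * y - (1 - k/2))]) (by
      refine Summable.of_norm_bounded (g := fun j => K * x * c j) (hsumc.mul_left _) fun j => ?_
      have h5 : 0 ≤ x * c j := mul_nonneg hx.le (hcn _)
      rw [hell x (c j) h5]
      refine (hKe _ h5).trans ?_
      have := Real.log_le_sub_one_of_pos (show 0 < 1 + x * c j by linarith)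
      rw [mul_assoc]
      gcongr
      linarith)
  have e1 : ∀ j, Real.log ‖1 - ((x:ℂ) * ⟨1 - k/2, s⟩) * (c j:ℂ)‖ = ell k (x * c j) := fun j =>
    hell x (c j) (mul_nonneg hx.le (hcn _))
  simp only [e1, norm_mul, hw, Complex.norm_real, Real.norm_of_nonneg hx.le, mul_one] at this
  refine this.trans (le_of_eq ?_)
  congr 2
  ext i
  congr 2
  ring

/-- the trace argument for `α = 1` -/
theorem core_one [CompleteSpace H] (e : ℕ → H) (he : Orthonormal ℂ e) {a : ℝ} (ha : 0 < a)
    (c : ℕ → ℝ) (hc : Antitone c)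
    (hcl : Tendsto (fun j : ℕ => ((j:ℝ)+1) ^ (1:ℝ) * c j) atTop (𝓝 a))
    (C T A : H →L[ℂ] H) (hA : A = C + T) (hC : ∀ j, ‖C - partC e c j‖ ≤ c j)
    (hT : Tendsto (fun j : ℕ => ((j:ℝ)+1) ^ (1:ℝ) * sNum T (j+1)) atTop (𝓝 0))
    (hTs : Summable fun j : ℕ => sNum T (j+1))
    (hunit : ∀ z : ℂ, IsUnit (1 - z • A)) : False := by
  have hcn : ∀ j, 0 ≤ c j := fun j => (norm_nonneg _).trans (hC j)
  have hτn := majT_nonneg T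
  have hτl := majT_tendsto T one_lt_two hT
  obtain ⟨B, hB, hBc⟩ := exists_bound_of_tendsto c hcl
  obtain ⟨B', hB', hBt⟩ := exists_bound_of_tendsto _ hτl
  have hsumt : Summable (majT T) := hTs.add (summable_shift_rpow one_lt_two)
  have hlim := limit_one e he c (majT T) hc (majT_anti T) (tendsto_zero_of_bound one_pos c hcn hBc)
    (tendsto_zero_of_bound one_pos _ hτn hBt) hτn C T A hA hC (majT_approx T) hunit
    (sigma_summable (β := 1) one_pos (by norm_num) (by norm_num) c (majT T) hcn hτn hB hB' hBc hBt) hsumt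
  have hbd : ∀ J, ∑ j ∈ Finset.range J, c j ≤ 4 * ∑' i, majT T i := by
    intro J
    have hlogx : ∀ j, Tendsto (fun x : ℝ => Real.log (1 + x * c j) / x) atTop (𝓝 0) := by
      intro j
      have hb : Tendsto (fun x : ℝ => 2 * (c j) ^ (1/2:ℝ) * x ^ (-(1/2:ℝ))) atTop (𝓝 0) := by
        have := (tendsto_rpow_neg_atTop (show (0:ℝ) < 1/2 by norm_num)).const_mul (2 * (c j) ^ (1/2:ℝ))
        rwa [mul_zero] at this
      refine squeeze_zero' ?_ ?_ hb
      · filter_upwards [eventually_gt_atTop 0] with x hx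
        have := mul_nonneg hx.le (hcn j)
        exact div_nonneg (Real.log_nonneg (by linarith)) hx.le
      · filter_upwards [eventually_gt_atTop 0] with x hx
        have h3 := log_one_add_le_rpow (δ := 1/2) (mul_nonneg hx.le (hcn j)) (by norm_num) (by norm_num)
        rw [div_le_iff₀ hx]
        refine h3.trans (le_of_eq ?_)
        rw [Real.mul_rpow hx.le (hcn j)]
        have : x ^ (-(1/2:ℝ)) * x = x ^ (1/2:ℝ) := by
          nth_rewrite 2 [← Real.rpow_one x]
          rw [← Real.rpow_add hx]; norm_num
        rw [mul_assoc, this]; ring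
    have hsum : Tendsto (fun x : ℝ => ∑ j ∈ Finset.range J, (Real.log (1 + x * c j) / x - c j) + 4 * ∑' i, majT T i)
        atTop (𝓝 (∑ j ∈ Finset.range J, (0 - c j) + 4 * ∑' i, majT T i)) :=
      (tendsto_finsetSum _ fun j _ => (hlogx j).sub_const _).add_const _
    have := ge_of_tendsto hsum (b := 0) (by
      filter_upwards [eventually_gt_atTop 0] with x hx
      have h3 := div_nonneg (hlim x hx J) hx.le
      refine h3.trans (le_of_eq ?_)
      rw [add_div, Finset.sum_div]
      congr 1
      · refine Finset.sum_congr rfl fun j _ => ?_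
        field_simp
      · field_simp)
    simp only [zero_sub, Finset.sum_neg_distrib] at this
    linarith
  have hsc : Summable c := summable_of_sum_range_le hcn hbd
  have hev : ∀ᶠ j : ℕ in atTop, a / 2 * ((j:ℝ)+1)⁻¹ ≤ c j := by
    filter_upwards [hcl.eventually (lt_mem_nhds (show a/2 < a by linarith))] with j hj
    rw [Real.rpow_one] at hj
    have : (0:ℝ) < (j:ℝ)+1 := by positivity
    rw [← div_eq_mul_inv, div_le_iff₀ this]
    linarith
  have hs2 : Summable fun j : ℕ => a / 2 * ((j:ℝ)+1)⁻¹ := by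
    refine Summable.of_norm_bounded_eventually_nat hsc ?_
    filter_upwards [hev] with j hj
    rw [Real.norm_of_nonneg (by positivity)]
    exact hj
  have hs3 : Summable fun j : ℕ => ((j:ℝ)+1)⁻¹ := (summable_mul_left_iff (by positivity)).1 hs2
  have hs4 := (summable_nat_add_iff (f := fun n : ℕ => ((n:ℝ))⁻¹) 1).1 (by simpa using hs3)
  exact Real.not_summable_natCast_inv hs4

end PartP9

section PartP10

open MeasureTheory

variable {H : Type*} [NormedAddCommGroup H] [InnerProductSpace ℂ H]

theorem olivier (f : ℕ → ℝ) (hf : Antitone f) (hn : ∀ n, 0 ≤ f n) (hs : Summable f) :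
    Tendsto (fun n : ℕ => ((n:ℝ)+1) * f n) atTop (𝓝 0) := by
  have h1 := hs.hasSum.tendsto_sum_nat
  have t1 : Tendsto (fun n : ℕ => n / 2) atTop atTop := Nat.tendsto_div_const_atTop two_ne_zero
  have h2 := ((h1.comp (tendsto_add_atTop_nat 1)).sub (h1.comp t1)).const_mul 2
  rw [sub_self, mul_zero] at h2
  refine squeeze_zero (fun n => mul_nonneg (by positivity) (hn n)) (fun n => ?_) h2
  simp only [Function.comp]
  rw [← Finset.sum_Ico_eq_sub _ (show n / 2 ≤ n + 1 by omega)]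
  have h3 : ((Finset.Ico (n/2) (n+1)).card : ℝ) * f n ≤ ∑ i ∈ Finset.Ico (n/2) (n+1), f i := by
    rw [← nsmul_eq_mul]
    refine Finset.card_nsmul_le_sum _ _ _ fun i hi => hf ?_
    have := (Finset.mem_Ico.1 hi).2
    omega
  rw [Nat.card_Ico] at h3
  have h4 : ((n:ℝ)+1) ≤ 2 * ((n + 1 - n/2 : ℕ) : ℝ) := by
    have : n + 1 ≤ 2 * (n + 1 - n/2) := by omega
    exact_mod_cast this
  have := mul_le_mul_of_nonneg_right h4 (hn n)
  linarith

theorem little_of_schatten (T : H →L[ℂ] H) {α q : ℝ} (hα : 0 < α) (hq : 0 < q) (hqα : q ≤ 1 / α)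
    (hT : Summable (fun n : ℕ => sNum T (n + 1) ^ q)) :
    Tendsto (fun j : ℕ => ((j:ℝ)+1) ^ α * sNum T (j+1)) atTop (𝓝 0) := by
  have h1 := olivier _ (fun i j hij => Real.rpow_le_rpow (sNum_nonneg _ _) (sNum_anti T hij) hq.le)
    (fun n => Real.rpow_nonneg (sNum_nonneg T (n+1)) q) hT
  have h2 := h1.rpow_const (p := 1/q) (Or.inr (by positivity))
  rw [Real.zero_rpow (by positivity)] at h2
  refine squeeze_zero (fun n => mul_nonneg (by positivity) (sNum_nonneg _ _)) (fun n => ?_) h2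
  rw [Real.mul_rpow (by positivity) (Real.rpow_nonneg (sNum_nonneg _ _) _), ← Real.rpow_mul (sNum_nonneg _ _),
    mul_one_div_cancel hq.ne', Real.rpow_one]
  refine mul_le_mul_of_nonneg_right ?_ (sNum_nonneg _ _)
  apply Real.rpow_le_rpow_of_exponent_le
  · have : (0:ℝ) ≤ n := Nat.cast_nonneg n
    linarith
  · rw [le_div_iff₀ hα] at hqα
    rw [le_div_iff₀ hq]
    linarith

/-- weighted singular numbers -/
noncomputable def wS (X : H →L[ℂ] H) (β : ℝ) (j : ℕ) : ℝ := ((j:ℝ)+1) ^ β * sNum X (j+1)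

theorem wS_nonneg (X : H →L[ℂ] H) (β : ℝ) (j : ℕ) : 0 ≤ wS X β j :=
  mul_nonneg (by positivity) (sNum_nonneg _ _)

theorem double_rpow_le {β : ℝ} (hβ : 0 ≤ β) (j : ℕ) :
    ((j:ℝ)+1) ^ β ≤ 2 ^ β * (((j/2:ℕ):ℝ)+1) ^ β := by
  rw [← Real.mul_rpow (by norm_num) (by positivity)]
  apply Real.rpow_le_rpow (by positivity) _ hβ
  have : j + 1 ≤ 2 * (j/2 + 1) := by omega
  exact_mod_cast this

theorem wS_add (X Y : H →L[ℂ] H) {β : ℝ} (hβ : 0 ≤ β) (j : ℕ) :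
    wS (X + Y) β j ≤ 2 ^ β * (wS X β (j/2) + wS Y β (j/2)) := by
  have h1 : sNum (X + Y) (j+1) ≤ sNum X (j/2+1) + sNum Y (j/2+1) :=
    (sNum_anti (X+Y) (show j/2 + j/2 ≤ j by omega)).trans (sNum_add_le X Y (j/2) (j/2))
  unfold wS
  calc ((j:ℝ)+1) ^ β * sNum (X + Y) (j+1) ≤
      (2 ^ β * (((j/2:ℕ):ℝ)+1) ^ β) * (sNum X (j/2+1) + sNum Y (j/2+1)) :=
        mul_le_mul (double_rpow_le hβ j) h1 (sNum_nonneg _ _) (by positivity)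
    _ = _ := by ring

theorem wS_mul (X Y : H →L[ℂ] H) {β γ : ℝ} (hβ : 0 ≤ β) (hγ : 0 ≤ γ) (j : ℕ) :
    wS (X * Y) (β + γ) j ≤ 2 ^ (β + γ) * (wS X β (j/2) * wS Y γ (j/2)) := by
  have h1 : sNum (X * Y) (j+1) ≤ sNum X (j/2+1) * sNum Y (j/2+1) :=
    (sNum_anti (X*Y) (show j/2 + j/2 ≤ j by omega)).trans (sNum_mul_le X Y (j/2) (j/2))
  unfold wS
  calc ((j:ℝ)+1) ^ (β+γ) * sNum (X * Y) (j+1) ≤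
      (2 ^ (β+γ) * (((j/2:ℕ):ℝ)+1) ^ (β+γ)) * (sNum X (j/2+1) * sNum Y (j/2+1)) :=
        mul_le_mul (double_rpow_le (by linarith) j) h1 (sNum_nonneg _ _) (by positivity)
    _ = _ := by
      rw [Real.rpow_add (show (0:ℝ) < ((j/2:ℕ):ℝ)+1 by positivity)]
      ring

theorem tendsto_half : Tendsto (fun n : ℕ => n / 2) atTop atTop := Nat.tendsto_div_const_atTop two_ne_zero

theorem little_add {X Y : H →L[ℂ] H} {β : ℝ} (hβ : 0 ≤ β) (hX : Tendsto (wS X β) atTop (𝓝 0))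
    (hY : Tendsto (wS Y β) atTop (𝓝 0)) : Tendsto (wS (X + Y) β) atTop (𝓝 0) := by
  have := ((hX.comp tendsto_half).add (hY.comp tendsto_half)).const_mul (2 ^ β)
  rw [add_zero, mul_zero] at this
  exact squeeze_zero (wS_nonneg _ _) (wS_add X Y hβ) this

theorem big_add {X Y : H →L[ℂ] H} {β : ℝ} (hβ : 0 ≤ β) (hX : ∃ B, ∀ j, wS X β j ≤ B)
    (hY : ∃ B, ∀ j, wS Y β j ≤ B) : ∃ B, ∀ j, wS (X + Y) β j ≤ B := by
  obtain ⟨B, hB⟩ := hX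
  obtain ⟨B', hB'⟩ := hY
  refine ⟨2 ^ β * (B + B'), fun j => (wS_add X Y hβ j).trans ?_⟩
  have := hB (j/2)
  have := hB' (j/2)
  gcongr

theorem big_mul {X Y : H →L[ℂ] H} {β γ : ℝ} (hβ : 0 ≤ β) (hγ : 0 ≤ γ) (hX : ∃ B, ∀ j, wS X β j ≤ B)
    (hY : ∃ B, ∀ j, wS Y γ j ≤ B) : ∃ B, ∀ j, wS (X * Y) (β + γ) j ≤ B := by
  obtain ⟨B, hB⟩ := hX
  obtain ⟨B', hB'⟩ := hY
  refine ⟨2 ^ (β + γ) * (B * B'), fun j => (wS_mul X Y hβ hγ j).trans ?_⟩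
  have h1 := hB (j/2)
  have h2 := hB' (j/2)
  have := mul_le_mul h1 h2 (wS_nonneg _ _ _) ((wS_nonneg _ _ _).trans h1)
  gcongr

theorem little_mul_right {X Y : H →L[ℂ] H} {β γ : ℝ} (hβ : 0 ≤ β) (hγ : 0 ≤ γ) (hX : ∃ B, ∀ j, wS X β j ≤ B)
    (hY : Tendsto (wS Y γ) atTop (𝓝 0)) : Tendsto (wS (X * Y) (β + γ)) atTop (𝓝 0) := by
  obtain ⟨B, hB⟩ := hX
  have := ((hY.comp tendsto_half).const_mul B).const_mul (2 ^ (β + γ))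
  rw [mul_zero, mul_zero] at this
  refine squeeze_zero (wS_nonneg _ _) (fun j => (wS_mul X Y hβ hγ j).trans ?_) this
  have := mul_le_mul_of_nonneg_right (hB (j/2)) (wS_nonneg Y γ (j/2))
  simp only [Function.comp]
  gcongr

theorem little_mul_left {X Y : H →L[ℂ] H} {β γ : ℝ} (hβ : 0 ≤ β) (hγ : 0 ≤ γ) (hX : ∃ B, ∀ j, wS X β j ≤ B)
    (hY : Tendsto (wS Y γ) atTop (𝓝 0)) : Tendsto (wS (Y * X) (γ + β)) atTop (𝓝 0) := by
  obtain ⟨B, hB⟩ := hX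
  have := ((hY.comp tendsto_half).const_mul B).const_mul (2 ^ (γ + β))
  rw [mul_zero, mul_zero] at this
  refine squeeze_zero (wS_nonneg _ _) (fun j => (wS_mul Y X hγ hβ j).trans ?_) this
  have := mul_le_mul_of_nonneg_right (hB (j/2)) (wS_nonneg Y γ (j/2))
  simp only [Function.comp]
  rw [mul_comm (wS Y γ (j/2))]
  gcongr

theorem big_of_tendsto {X : H →L[ℂ] H} {β l : ℝ} (hX : Tendsto (wS X β) atTop (𝓝 l)) :
    ∃ B, ∀ j, wS X β j ≤ B := by
  obtain ⟨B, hB⟩ := hX.bddAbove_range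
  exact ⟨B, fun j => hB ⟨j, rfl⟩⟩

theorem big_pow {A : H →L[ℂ] H} {α : ℝ} (hα : 0 ≤ α) (hA : ∃ B, ∀ j, wS A α j ≤ B) (n : ℕ) :
    ∃ B, ∀ j, wS (A ^ (n+1)) (α * ((n:ℝ)+1)) j ≤ B := by
  induction n with
  | zero => simpa using hA
  | succ n ih =>
    have := big_mul (by positivity) hα ih hA
    rw [pow_succ]
    have e : α * (((n+1:ℕ):ℝ)+1) = α * ((n:ℝ)+1) + α := by push_cast; ring
    rw [e]; exact this

theorem little_pow_sub {A C T : H →L[ℂ] H} (hA : A = C + T) {α : ℝ} (hα : 0 ≤ α)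
    (hC : ∃ B, ∀ j, wS C α j ≤ B) (hT : Tendsto (wS T α) atTop (𝓝 0)) (n : ℕ) :
    Tendsto (wS (A ^ (n+1) - C ^ (n+1)) (α * ((n:ℝ)+1))) atTop (𝓝 0) := by
  have hAb : ∃ B, ∀ j, wS A α j ≤ B := by
    rw [hA]; exact big_add hα hC (big_of_tendsto hT)
  induction n with
  | zero =>
    have : A ^ (0+1) - C ^ (0+1) = T := by rw [zero_add, pow_one, pow_one, hA]; abel
    rw [this]; simpa using hT
  | succ n ih =>
    have e : α * (((n+1:ℕ):ℝ)+1) = α * ((n:ℝ)+1) + α := by push_cast; ring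
    have e2 : A ^ (n+1+1) - C ^ (n+1+1) = A ^ (n+1) * T + (A ^ (n+1) - C ^ (n+1)) * C := by
      rw [pow_succ A (n+1), pow_succ C (n+1)]
      have : T = A - C := by rw [hA]; abel
      rw [this]; noncomm_ring
    rw [e, e2]
    exact little_add (by positivity) (little_mul_right (by positivity) hα (big_pow hα hAb n) hT)
      (little_mul_left hα (by positivity) hC ih)

theorem partC_mul_partC (e : ℕ → H) (he : Orthonormal ℂ e) (c d : ℕ → ℝ) (N : ℕ) :
    partC e c N * partC e d N = partC e (fun j => c j * d j) N := by
  ext x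
  rw [mul_apply_eq_comp, partC_apply, partC_apply e (fun j => c j * d j)]
  refine Finset.sum_congr rfl fun j hj => ?_
  rw [partC_apply, he.inner_right_sum _ hj]
  push_cast
  rw [mul_assoc]

theorem partC_pow (e : ℕ → H) (he : Orthonormal ℂ e) (c : ℕ → ℝ) (N n : ℕ) :
    partC e c N ^ (n+1) = partC e (fun j => c j ^ (n+1)) N := by
  induction n with
  | zero => simp
  | succ n ih =>
    rw [pow_succ, ih, partC_mul_partC e he]
    simp only [pow_succ]

theorem pow_approx (e : ℕ → H) (he : Orthonormal ℂ e) (c : ℕ → ℝ) (C : H →L[ℂ] H)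
    (hp : C.IsPositive) (hCe : ∀ j, C (e j) = (c j : ℂ) • e j) (j n : ℕ)
    (hC : ‖C - partC e c j‖ ≤ c j) : ‖C ^ (n+1) - partC e (fun j => c j ^ (n+1)) j‖ ≤ c j ^ (n+1) := by
  set P := partC e c j with hP
  have hPP := partC_mul_partC e he c c j
  rw [← hP] at hPP
  have h1 : C * P = P * P := by
    rw [hPP]
    ext x
    rw [mul_apply_eq_comp, hP, partC_apply, partC_apply, map_sum]
    refine Finset.sum_congr rfl fun i _ => ?_
    rw [map_smul, hCe, smul_smul]
    push_cast
    congr 1; ring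
  have h2 : P * C = P * P := by
    rw [hPP]
    ext x
    rw [mul_apply_eq_comp, hP, partC_apply, partC_apply]
    refine Finset.sum_congr rfl fun i _ => ?_
    have h3 : inner ℂ (C (e i)) x = inner ℂ (e i) (C x) := hp.isSymmetric (e i) x
    rw [← h3, hCe, inner_smul_left, Complex.conj_ofReal]
    push_cast
    congr 1; ring
  set R := C - P with hR
  have hRP : R * P = 0 := by rw [hR, sub_mul, h1, sub_self]
  have hPR : P * R = 0 := by rw [hR, mul_sub, h2, sub_self]
  have hpow : ∀ n, C ^ (n+1) = R ^ (n+1) + P ^ (n+1) := by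
    intro n
    induction n with
    | zero => simp [hR]
    | succ n ih =>
      have hCRP : C = R + P := by rw [hR]; abel
      rw [pow_succ, ih, hCRP, add_mul, mul_add, mul_add]
      have a1 : R ^ (n+1) * P = 0 := by rw [pow_succ, mul_assoc, hRP, mul_zero]
      have a2 : P ^ (n+1) * R = 0 := by rw [pow_succ, mul_assoc, hPR, mul_zero]
      rw [a1, a2, add_zero, zero_add, ← pow_succ, ← pow_succ]
  rw [← partC_pow e he, ← hP, hpow, add_sub_cancel_right]
  exact (norm_pow_le' _ (Nat.succ_pos n)).trans (pow_le_pow_left₀ (norm_nonneg _) hC _)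

theorem unit_of_spectrum (X : H →L[ℂ] H) (hX : ∀ μ : ℂ, μ ≠ 0 → μ ∉ spectrum ℂ X) (z : ℂ) :
    IsUnit (1 - z • X) := by
  by_cases hz : z = 0
  · simp [hz]
  · have h1 := spectrum.notMem_iff.1 (hX z⁻¹ (inv_ne_zero hz))
    have h2 := h1.smul (Units.mk0 z hz)
    convert h2 using 1
    rw [Units.smul_def, Units.val_mk0, smul_sub, Algebra.algebraMap_eq_smul_one, smul_smul, mul_inv_cancel₀ hz, one_smul]

theorem main_thm [CompleteSpace H] (A C T : H →L[ℂ] H) (hA : A = C + T)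
    (hCcompact : IsCompactOperator (⇑C)) (hCpos : C.IsPositive)
    (hTcompact : IsCompactOperator (⇑T))
    (α a q : ℝ) (hα0 : 0 < α) (hα2 : α < 2) (ha0 : 0 < a)
    (hCα : Tendsto (fun n : ℕ => (n : ℝ) ^ α * sNum C n) atTop (𝓝 a))
    (hq0 : 0 < q) (hqα : q ≤ 1 / α)
    (hT : Summable (fun n : ℕ => sNum T (n + 1) ^ q)) :
    ∃ μ : ℂ, μ ≠ 0 ∧ Module.End.HasEigenvalue (A : H →ₗ[ℂ] H) μ := by
  by_contra hcon
  push Not at hcon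
  have hAc : IsCompactOperator (⇑A) := by
    rw [hA]; exact hCcompact.add hTcompact
  have hspec : ∀ μ : ℂ, μ ≠ 0 → μ ∉ spectrum ℂ A := fun μ hμ h =>
    hcon μ hμ ((hAc.hasEigenvalue_iff_mem_spectrum hμ).2 h)
  have hcl : Tendsto (wS C α) atTop (𝓝 a) := by
    refine (hCα.comp (tendsto_add_atTop_nat 1)).congr fun n => ?_
    simp [wS]
  have hpos : ∀ n, 0 < sNum C (n+1) := by
    intro n
    obtain ⟨m, hm, hnm⟩ := ((hcl.eventually (lt_mem_nhds ha0)).and (eventually_ge_atTop n)).exists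
    have h1 : 0 < sNum C (m+1) := by
      have h2 : (0:ℝ) < ((m:ℝ)+1) ^ α := by positivity
      exact pos_of_mul_pos_right hm h2.le
    exact h1.trans_le (sNum_anti C hnm)
  obtain ⟨e, c, he, hCe, hcs, hCn⟩ := spectral_seq C hCcompact hCpos hpos
  have hc : Antitone c := by
    have : c = fun j => sNum C (j+1) := funext hcs
    rw [this]; exact sNum_anti C
  have hcn : ∀ j, 0 ≤ c j := fun j => by rw [hcs]; exact sNum_nonneg _ _
  have hcl' : Tendsto (fun j : ℕ => ((j:ℝ)+1) ^ α * c j) atTop (𝓝 a) := by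
    refine hcl.congr fun j => ?_
    rw [hcs]; rfl
  have hTl := little_of_schatten T hα0 hq0 hqα hT
  rcases lt_trichotomy α 1 with hα1 | hα1 | hα1
  · set n := ⌊1/α⌋₊ with hn
    have hn1 : 1 < α * ((n:ℝ)+1) := by
      have := Nat.lt_floor_add_one (1/α)
      rw [div_lt_iff₀ hα0] at this
      linarith
    have hn2 : α * ((n:ℝ)+1) < 2 := by
      have := Nat.floor_le (show 0 ≤ 1/α by positivity)
      rw [le_div_iff₀ hα0] at this
      nlinarith
    refine core_op e he hn1 hn2 (pow_pos ha0 (n+1)) (fun j => c j ^ (n+1)) (fun i j hij =>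
      pow_le_pow_left₀ (hcn j) (hc hij) _) ?_ (C ^ (n+1)) (A ^ (n+1) - C ^ (n+1)) (A ^ (n+1)) (by abel)
      (fun j => pow_approx e he c C hCpos hCe j n (hCn j).le)
      (little_pow_sub hA hα0.le (big_of_tendsto hcl) hTl n) (unit_of_spectrum _ ?_)
    · refine (hcl'.pow (n+1)).congr fun j => ?_
      rw [mul_pow, Real.rpow_mul (by positivity)]
      congr 1
      rw [← Real.rpow_natCast]
      push_cast; rfl
    · intro μ hμ h
      rw [spectrum.map_pow_of_pos A (Nat.succ_pos n)] at h
      obtain ⟨ν, hν, rfl⟩ := h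
      exact hspec ν (by rintro rfl; simp at hμ) hν
  · subst hα1
    have hTs : Summable fun j : ℕ => sNum T (j+1) := by
      obtain ⟨B, hB, hBt⟩ := exists_bound_of_tendsto _ hTl
      have h0 := tendsto_zero_of_bound one_pos _ (fun j => sNum_nonneg T (j+1)) hBt
      refine Summable.of_norm_bounded_eventually_nat hT ?_
      filter_upwards [h0.eventually (gt_mem_nhds one_pos)] with j hj
      rw [Real.norm_of_nonneg (sNum_nonneg _ _)]
      rcases (sNum_nonneg T (j+1)).eq_or_lt with h | h
      · rw [← h, Real.zero_rpow hq0.ne']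
      · conv_lhs => rw [← Real.rpow_one (sNum T (j+1))]
        exact Real.rpow_le_rpow_of_exponent_ge h hj.le (by simpa using hqα)
    exact core_one e he ha0 c hc hcl' C T A hA (fun j => (hCn j).le) hTl hTs (unit_of_spectrum A hspec)
  · exact core_op e he hα1 hα2 ha0 c hc hcl' C T A hA (fun j => (hCn j).le) hTl (unit_of_spectrum A hspec)

end PartP10

/-- **Theorem 2.1.** If `A = C + T` with `C` a non-negative compact operator with
`n ^ 2 * s n (C) → ∞` and `n ^ α * s n (C) → a` for some `0 < α < 2`, `0 < a < ∞`, and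
`T` a compact operator in the Schatten–von Neumann class `S_q` for some `0 < q ≤ 1/α`,
then `A` cannot be Volterra, i.e. `A` has a nonzero eigenvalue. -/
theorem statement0 {H : Type*} [NormedAddCommGroup H] [InnerProductSpace ℂ H]
    [CompleteSpace H] (A C T : H →L[ℂ] H) (hA : A = C + T)
    (hCcompact : IsCompactOperator (⇑C)) (hCpos : C.IsPositive)
    (hTcompact : IsCompactOperator (⇑T))
    (α a q : ℝ) (hα0 : 0 < α) (hα2 : α < 2) (ha0 : 0 < a)
    (hC2 : Tendsto (fun n : ℕ => (n : ℝ) ^ 2 * sNum C n) atTop atTop)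
    (hCα : Tendsto (fun n : ℕ => (n : ℝ) ^ α * sNum C n) atTop (𝓝 a))
    (hq0 : 0 < q) (hqα : q ≤ 1 / α)
    (hT : Summable (fun n : ℕ => sNum T (n + 1) ^ q)) :
    ∃ μ : ℂ, μ ≠ 0 ∧ Module.End.HasEigenvalue (A : H →ₗ[ℂ] H) μ := by
  exact main_thm A C T hA hCcompact hCpos hTcompact α a q hα0 hα2 ha0 hCα hq0 hqα hT
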